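/- arXiv:2410.13703 — 5 statements merged into one kernel-verified Lean document; each statement's English description precedes it below -/
import Mathlib

section
/- Let ε > 0, let t ≥ 0, let E : [0,t]×ℝ³ → ℝ³ be continuous with |E(s,y)| ≤ ε (1+s²)^{-3/4} for all (s,y), and let (X,V) : [0,t] → ℝ³×ℝ³ be a C¹ solution of the backward characteristic system X'(s) = V̂(s) := V(s)/√(1+|V(s)|²), V'(s) = E(s, X(s)), with final data X(t) = x, V(t) = v. Then for all s ∈ [0,t], |V(s) − v| ≤ 4 ε (1+s²)^{-1/4}. -/
noncomputable section
open MeasureTheory Set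

abbrev E3 := EuclideanSpace ℝ (Fin 3)

/-- The Japanese bracket `⟨v⟩ = √(1+|v|²)`. -/
def jap (v : E3) : ℝ := Real.sqrt (1 + ‖v‖ ^ 2)

/-- The relativistic velocity `v̂ = v/⟨v⟩`. -/
def uhat (v : E3) : E3 := (jap v)⁻¹ • v

theorem one_add_sq_rpow_neg_three_quarters_le {u : ℝ} (hu : 0 ≤ u) :
    (1 + u ^ 2) ^ (-(3 / 4) : ℝ) ≤ 2 * (1 + u) ^ (-(3 / 2) : ℝ) := by
  have h1 : (1 + u) ^ (-(3 / 2) : ℝ) = ((1 + u) ^ 2) ^ (-(3 / 4) : ℝ) := by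
    rw [← Real.rpow_natCast_mul (by positivity)]
    norm_num
  have h2 : (2 * (1 + u ^ 2)) ^ (-(3 / 4) : ℝ) ≤ ((1 + u) ^ 2) ^ (-(3 / 4) : ℝ) :=
    Real.rpow_le_rpow_of_nonpos (by positivity) (by nlinarith [sq_nonneg (1 - u)]) (by norm_num)
  rw [Real.mul_rpow (by norm_num) (by positivity)] at h2
  have h3 : (2 : ℝ) ^ (-1 : ℝ) ≤ 2 ^ (-(3 / 4) : ℝ) :=
    Real.rpow_le_rpow_of_exponent_le (by norm_num) (by norm_num)
  rw [Real.rpow_neg_one] at h3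
  have h4 : 0 ≤ (1 + u ^ 2) ^ (-(3 / 4) : ℝ) := by positivity
  rw [h1]
  nlinarith [mul_le_mul_of_nonneg_right h3 h4]

theorem one_add_rpow_neg_half_le {u : ℝ} (hu : 0 ≤ u) :
    (1 + u) ^ (-(1 / 2) : ℝ) ≤ (1 + u ^ 2) ^ (-(1 / 4) : ℝ) := by
  have h1 : (1 + u) ^ (-(1 / 2) : ℝ) = ((1 + u) ^ 2) ^ (-(1 / 4) : ℝ) := by
    rw [← Real.rpow_natCast_mul (by positivity)]
    norm_num
  rw [h1]
  exact Real.rpow_le_rpow_of_nonpos (by positivity) (by nlinarith) (by norm_num)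

/-- if `‖E(s,y)‖ ≤ ε(1+s²)^{−3/4}` and `(X,V)` solves the backward
characteristic system `X' = V̂`, `V' = E(s,X)` on `[0,t]` with final data `X(t)=x`,
`V(t)=v`, then `‖V(s) − v‖ ≤ 4ε(1+s²)^{−1/4}` on `[0,t]`. -/
theorem stmt6 (ε t : ℝ) (hε : 0 < ε) (ht : 0 ≤ t) (x v : E3)
    (E : ℝ → E3 → E3)
    (hEcont : ContinuousOn (fun p : ℝ × E3 => E p.1 p.2) (Icc (0:ℝ) t ×ˢ (univ : Set E3)))
    (hEbd : ∀ s ∈ Icc (0:ℝ) t, ∀ y : E3, ‖E s y‖ ≤ ε * (1 + s ^ 2) ^ (-(3 / 4) : ℝ))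
    (X V : ℝ → E3)
    (hX : ∀ s ∈ Icc (0:ℝ) t, HasDerivWithinAt X (uhat (V s)) (Icc (0:ℝ) t) s)
    (hV : ∀ s ∈ Icc (0:ℝ) t, HasDerivWithinAt V (E s (X s)) (Icc (0:ℝ) t) s)
    (hXcont : ContinuousOn (fun s => uhat (V s)) (Icc (0:ℝ) t))
    (hVcont : ContinuousOn (fun s => E s (X s)) (Icc (0:ℝ) t))
    (hXt : X t = x) (hVt : V t = v) :
    ∀ s ∈ Icc (0:ℝ) t, ‖V s - v‖ ≤ 4 * ε * (1 + s ^ 2) ^ (-(1 / 4) : ℝ) := by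
  intro s hs
  have hB : ∀ u ∈ Icc s t, HasDerivAt
      (fun u : ℝ => 4 * ε * ((1 + s) ^ (-(1 / 2) : ℝ) - (1 + u) ^ (-(1 / 2) : ℝ)))
      (ε * (2 * (1 + u) ^ (-(3 / 2) : ℝ))) u := by
    intro u hu
    have hpos : (1 + u) ≠ 0 := by linarith [hs.1, hu.1]
    refine (((((hasDerivAt_id' u).const_add 1).rpow_const (p := -(1 / 2)) (Or.inl hpos)).const_sub
      ((1 + s) ^ (-(1 / 2) : ℝ))).const_mul (4 * ε)).congr_deriv ?_
    rw [show (-(1 / 2) - 1 : ℝ) = -(3 / 2) by norm_num]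
    ring
  have hsub : Icc s t ⊆ Icc 0 t := Icc_subset_Icc_left hs.1
  have key : ‖V t - V s‖ ≤ 4 * ε * ((1 + s) ^ (-(1 / 2) : ℝ) - (1 + t) ^ (-(1 / 2) : ℝ)) := by
    refine image_norm_le_of_norm_deriv_right_le_deriv_boundary' (f := fun u => V u - V s)
      (f' := fun u => E u (X u)) (a := s) (b := t)
      (fun u hu => (((hV u (hsub hu)).continuousWithinAt).mono hsub).sub
        continuousWithinAt_const) ?_ (by simp)
      (fun u hu => (hB u hu).continuousAt.continuousWithinAt)
      (fun u hu => (hB u (Ico_subset_Icc_self hu)).hasDerivWithinAt) ?_ (right_mem_Icc.2 hs.2)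
    · intro u hu
      have hu' := hsub (Ico_subset_Icc_self hu)
      refine ((hV u hu').sub_const (V s)).mono_of_mem_nhdsWithin ?_
      exact Filter.mem_of_superset (Icc_mem_nhdsGE hu.2) (Icc_subset_Icc_left hu'.1)
    · intro u hu
      have hu' := hsub (Ico_subset_Icc_self hu)
      exact (hEbd u hu' _).trans (mul_le_mul_of_nonneg_left
        (one_add_sq_rpow_neg_three_quarters_le hu'.1) hε.le)
  rw [← hVt, norm_sub_rev]
  refine key.trans (mul_le_mul_of_nonneg_left ?_ (by positivity))
  have ht0 : 0 ≤ (1 + t) ^ (-(1 / 2) : ℝ) := by positivity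
  linarith [one_add_rpow_neg_half_le hs.1]
end
end

section
/- Let v ∈ ℝ³, let ε ∈ [0, 1/4], and let w ∈ ℝ³ satisfy |w − v̂| ≤ ε⟨v⟩⁻², where ⟨v⟩ = √(1+|v|²) and v̂ = v/⟨v⟩. Then 1 − |w|² ≥ (1 − 3ε) ⟨v⟩⁻² > 0; in particular |w| < 1, so w lies in the open unit ball and w/√(1−|w|²) is well defined. -/
noncomputable section

lemma jap_sq (v : E3) : jap v ^ 2 = 1 + ‖v‖ ^ 2 :=
  Real.sq_sqrt (by positivity)

lemma norm_uhat_sq (v : E3) : ‖uhat v‖ ^ 2 = 1 - (jap v ^ 2)⁻¹ := by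
  have h : (0 : ℝ) < 1 + ‖v‖ ^ 2 := by positivity
  rw [uhat, norm_smul, mul_pow, Real.norm_eq_abs, sq_abs, inv_pow, jap_sq]
  field_simp
  ring

/-- if `‖w − v̂‖ ≤ ε⟨v⟩⁻²` with `0 ≤ ε ≤ 1/4`, then
`1 − |w|² ≥ (1 − 3ε)⟨v⟩⁻² > 0`; in particular `|w| < 1`. -/
theorem stmt8 (v : E3) (ε : ℝ) (hε0 : 0 ≤ ε) (hε : ε ≤ 1 / 4) (w : E3)
    (hw : ‖w - uhat v‖ ≤ ε * ((jap v) ^ 2)⁻¹) :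
    1 - ‖w‖ ^ 2 ≥ (1 - 3 * ε) * ((jap v) ^ 2)⁻¹ ∧
      0 < (1 - 3 * ε) * ((jap v) ^ 2)⁻¹ ∧
      ‖w‖ < 1 := by
  have hJ : 1 ≤ jap v ^ 2 := by
    rw [jap_sq]
    nlinarith [sq_nonneg ‖v‖]
  have hd0 : 0 < (jap v ^ 2)⁻¹ := by positivity
  have hd1 : (jap v ^ 2)⁻¹ ≤ 1 := inv_le_one_of_one_le₀ hJ
  have ha := norm_uhat_sq v
  have hwn : ‖w‖ ≤ ‖uhat v‖ + ε * (jap v ^ 2)⁻¹ := by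
    linarith [norm_sub_norm_le w (uhat v)]
  have ha0 := norm_nonneg (uhat v)
  generalize (jap v ^ 2)⁻¹ = d at *
  generalize ‖uhat v‖ = a at *
  have ha1 : a ≤ 1 := by nlinarith
  have hεd : 0 ≤ ε * d := by positivity
  have hw_sq : ‖w‖ ^ 2 ≤ (a + ε * d) ^ 2 := pow_le_pow_left₀ (norm_nonneg w) hwn 2
  have h_cross : ε * d * a ≤ ε * d := mul_le_of_le_one_right hεd ha1
  have h_quad : ε * d * (ε * d) ≤ ε * d := mul_le_of_le_one_right hεd (by nlinarith)
  have h_lower : (1 - 3 * ε) * d ≤ 1 - ‖w‖ ^ 2 := by linarith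
  have h_pos : 0 < (1 - 3 * ε) * d := mul_pos (by linarith) hd0
  exact ⟨h_lower, h_pos, (sq_lt_one_iff₀ (norm_nonneg w)).1 (by linarith)⟩
end
end

section
/- Let d ≥ 1 and δ > 0, and let σ : ℝ^d → ℂ be smooth with |∂^α σ(ξ)| ≤ C_α ⟨ξ⟩^{−δ−|α|} for every multi-index α, where ⟨ξ⟩ = √(1+|ξ|²). Then for every p ∈ [1,∞] there is a constant C such that for every Schwartz function f : ℝ^d → ℂ, the Fourier multiplier σ(i∂)f := F⁻¹(σ · f̂) satisfies ‖σ(i∂)f‖_{L^p(ℝ^d)} ≤ C ‖f‖_{L^p(ℝ^d)}. -/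
noncomputable section
open MeasureTheory
open scoped FourierTransform ENNReal NNReal

open Filter Topology
open scoped SchwartzMap Convolution ContDiff

variable {E : Type*} [NormedAddCommGroup E] [InnerProductSpace ℝ E] [FiniteDimensional ℝ E]
  [MeasurableSpace E] [BorelSpace E]

/-- Young's inequality `‖k ⋆ f‖_p ≤ ‖k‖_1 ‖f‖_p`. -/
theorem eLpNorm_convolution_le {k f : E → ℂ} (hk : StronglyMeasurable k)
    (hf : StronglyMeasurable f) {p : ℝ≥0∞} (hp : 1 ≤ p) :
    eLpNorm (k ⋆[ContinuousLinearMap.mul ℂ ℂ] f) p volume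
      ≤ eLpNorm k 1 volume * eLpNorm f p volume := by
  set A := eLpNorm k 1 volume with hA
  have hkm : Measurable fun y => ‖k y‖ₑ := hk.enorm
  set ν : Measure E := volume.withDensity fun y => ‖k y‖ₑ with hν
  have hνA : ν Set.univ = A := by
    rw [hν, withDensity_apply _ MeasurableSet.univ, setLIntegral_univ, hA,
      eLpNorm_one_eq_lintegral_enorm]
  have hfm : ∀ x, StronglyMeasurable fun y => f (x - y) := fun x =>
    hf.comp_measurable (measurable_const.sub measurable_id)
  have hpt : ∀ x, ‖(k ⋆[ContinuousLinearMap.mul ℂ ℂ] f) x‖ₑ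
      ≤ eLpNorm (fun y => f (x - y)) p ν * A ^ (1 - 1 / p.toReal) := by
    intro x
    calc ‖(k ⋆[ContinuousLinearMap.mul ℂ ℂ] f) x‖ₑ
        ≤ ∫⁻ y, ‖k y * f (x - y)‖ₑ := enorm_integral_le_lintegral_enorm _
      _ = ∫⁻ y, ‖f (x - y)‖ₑ ∂ν := by
          rw [hν, lintegral_withDensity_eq_lintegral_mul _ hkm (hfm x).enorm]
          simp [enorm_mul]
      _ = eLpNorm (fun y => f (x - y)) 1 ν := by rw [eLpNorm_one_eq_lintegral_enorm]
      _ ≤ _ := by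
          simpa [hνA] using eLpNorm_le_eLpNorm_mul_rpow_measure_univ (μ := ν) hp
            (hfm x).aestronglyMeasurable
  rcases eq_or_ne p ⊤ with rfl | hp_top
  · refine eLpNormEssSup_le_of_ae_enorm_bound (ae_of_all _ fun x => (hpt x).trans ?_)
    simp only [ENNReal.toReal_top, div_zero, sub_zero, ENNReal.rpow_one]
    rw [mul_comm]
    gcongr
    exact (eLpNormEssSup_mono_measure _ (withDensity_absolutelyContinuous _ _)).trans_eq
      (eLpNorm_comp_measurePreserving (p := ⊤) hf.aestronglyMeasurable
        (Measure.measurePreserving_sub_left volume x))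
  · have hp0 : p ≠ 0 := (zero_lt_one.trans_le hp).ne'
    have hq : 0 < p.toReal := ENNReal.toReal_pos hp0 hp_top
    have hq1 : 1 ≤ p.toReal := by
      simpa using ENNReal.toReal_mono hp_top hp
    set q := p.toReal with hqdef
    have : SFinite ν := by rw [hν]; infer_instance
    have hpow : ∀ {g : E → ℂ} {μ : Measure E}, eLpNorm g p μ ^ q = ∫⁻ x, ‖g x‖ₑ ^ q ∂μ := by
      intro g μ
      rw [eLpNorm_eq_lintegral_rpow_enorm_toReal hp0 hp_top, ← ENNReal.rpow_mul, one_div,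
        inv_mul_cancel₀ hq.ne', ENNReal.rpow_one]
    have hfm2 : Measurable fun z : E × E => ‖f (z.1 - z.2)‖ₑ ^ q :=
      (hf.comp_measurable measurable_sub).enorm.pow_const q
    rw [← ENNReal.rpow_le_rpow_iff hq, ENNReal.mul_rpow_of_nonneg _ _ hq.le, hpow, hpow]
    calc ∫⁻ x, ‖(k ⋆[ContinuousLinearMap.mul ℂ ℂ] f) x‖ₑ ^ q
        ≤ ∫⁻ x, (∫⁻ y, ‖f (x - y)‖ₑ ^ q ∂ν) * A ^ (q - 1) := by
          refine lintegral_mono fun x => (ENNReal.rpow_le_rpow (hpt x) hq.le).trans_eq ?_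
          rw [ENNReal.mul_rpow_of_nonneg _ _ hq.le, hpow, ← ENNReal.rpow_mul]
          congr 2
          field_simp
      _ = (∫⁻ x, ∫⁻ y, ‖f (x - y)‖ₑ ^ q ∂ν) * A ^ (q - 1) := by
          rw [lintegral_mul_const]
          exact Measurable.lintegral_prod_right' hfm2
      _ = (∫⁻ y, (∫⁻ x, ‖f (x - y)‖ₑ ^ q) ∂ν) * A ^ (q - 1) := by
          rw [lintegral_lintegral_swap hfm2.aemeasurable]
      _ = A ^ q * ∫⁻ x, ‖f x‖ₑ ^ q := by
          simp_rw [fun y => lintegral_sub_right_eq_self (μ := volume) (fun x => ‖f x‖ₑ ^ q) y]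
          rw [lintegral_const, hνA, mul_assoc, mul_comm]
          congr 1
          nth_rw 1 [← ENNReal.rpow_one A]
          rw [← ENNReal.rpow_add_of_nonneg _ _ zero_le_one (sub_nonneg.2 hq1)]
          congr 1
          ring

theorem eLpNorm_fourierInv_mul_le (g f : 𝓢(E, ℂ)) {p : ℝ≥0∞} (hp : 1 ≤ p) :
    eLpNorm (𝓕⁻ (fun ξ => g ξ * 𝓕 (⇑f) ξ)) p volume
      ≤ eLpNorm (𝓕⁻ (⇑g)) 1 volume * eLpNorm f p volume := by
  have h : 𝓕⁻ (fun ξ => g ξ * 𝓕 (⇑f) ξ)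
      = (⇑(𝓕⁻ g : 𝓢(E, ℂ))) ⋆[ContinuousLinearMap.mul ℂ ℂ] (⇑f) := by
    ext x
    rw [← SchwartzMap.convolution_apply]
    have : (fun ξ => g ξ * 𝓕 (⇑f) ξ)
        = ⇑(SchwartzMap.pairing (ContinuousLinearMap.mul ℂ ℂ) (𝓕 (𝓕⁻ g)) (𝓕 f)) := by
      ext ξ
      simp [SchwartzMap.fourier_coe]
    rw [this, ← SchwartzMap.fourierInv_coe]
    rfl
  rw [h, ← SchwartzMap.fourierInv_coe]
  exact eLpNorm_convolution_le (SchwartzMap.continuous _).stronglyMeasurable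
    f.continuous.stronglyMeasurable hp

variable (E) in
/-- The seminorm `g ↦ ‖𝓕⁻ g‖_{L¹}` on Schwartz functions. -/
def fourierInvL1Seminorm : Seminorm ℂ 𝓢(E, ℂ) :=
  (normSeminorm ℂ (Lp ℂ 1 (volume : Measure E))).comp
    (SchwartzMap.toLpCLM ℂ ℂ 1 volume ∘L
      FourierTransform.fourierInvCLM ℂ 𝓢(E, ℂ)).toLinearMap

theorem fourierInvL1Seminorm_apply (g : 𝓢(E, ℂ)) :
    fourierInvL1Seminorm E g = ∫ x, ‖𝓕⁻ (⇑g) x‖ := by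
  rw [← SchwartzMap.fourierInv_coe, ← SchwartzMap.norm_toLp_one]
  rfl

theorem ofReal_fourierInvL1Seminorm (g : 𝓢(E, ℂ)) :
    ENNReal.ofReal (fourierInvL1Seminorm E g) = eLpNorm (𝓕⁻ (⇑g)) 1 volume := by
  have : fourierInvL1Seminorm E g = ‖(𝓕⁻ g).toLp 1 volume‖ := rfl
  rw [this, ← SchwartzMap.fourierInv_coe, SchwartzMap.norm_toLp,
    ENNReal.ofReal_toReal (SchwartzMap.eLpNorm_lt_top _ _ _).ne]

variable (E) in
theorem exists_fourierInvL1Seminorm_le : ∃ (s : Finset (ℕ × ℕ)) (C : ℝ≥0),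
    fourierInvL1Seminorm E ≤ C • s.sup (schwartzSeminormFamily ℂ E ℂ) := by
  obtain ⟨s, C, -, h⟩ := Seminorm.bound_of_continuous (schwartz_withSeminorms ℂ E ℂ)
    (fourierInvL1Seminorm E) (continuous_norm.comp
      (SchwartzMap.toLpCLM ℂ ℂ 1 volume ∘L FourierTransform.fourierInvCLM ℂ 𝓢(E, ℂ)).continuous)
  exact ⟨s, C, h⟩

theorem fourierInvL1Seminorm_eq_of_comp_smul {g s : 𝓢(E, ℂ)} {R : ℝ} (hR : 0 < R)
    (h : ∀ η, s η = g (R • η)) : fourierInvL1Seminorm E s = fourierInvL1Seminorm E g := by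
  have key : ∀ y, 𝓕⁻ (⇑s) y = (R ^ Module.finrank ℝ E)⁻¹ • 𝓕⁻ (⇑g) (R⁻¹ • y) := by
    intro y
    rw [Real.fourierInv_eq, Real.fourierInv_eq,
      ← abs_of_pos (inv_pos.2 (pow_pos hR (Module.finrank ℝ E))),
      ← Measure.integral_comp_smul volume]
    congr 1 with η
    simp [h, inner_smul_left, inner_smul_right, hR.ne']
  rw [fourierInvL1Seminorm_apply, fourierInvL1Seminorm_apply]
  simp_rw [key, norm_smul]
  rw [integral_const_mul, Measure.integral_comp_inv_smul volume (fun y => ‖𝓕⁻ (⇑g) y‖)]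
  simp [abs_of_pos hR, hR.ne']

omit [FiniteDimensional ℝ E] [MeasurableSpace E] [BorelSpace E] in
/-- Derivative bounds for symbols of order `-δ`. -/
theorem norm_iteratedFDeriv_comp_smul_le {σ : E → ℂ} (hσ : ContDiff ℝ ∞ σ) {δ Cn : ℝ} {n : ℕ}
    (hδ : 0 < δ)
    (hbd : ∀ ξ, ‖iteratedFDeriv ℝ n σ ξ‖ ≤ Cn * (1 + ‖ξ‖ ^ 2) ^ (-(δ + n) / 2 : ℝ))
    {R : ℝ} (hR : 0 < R) {η : E} (hη : 1 ≤ ‖η‖) :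
    ‖iteratedFDeriv ℝ n (fun η => σ (R • η)) η‖ ≤ Cn * R ^ (-δ) := by
  have hC : 0 ≤ Cn := by simpa using (norm_nonneg _).trans (hbd 0)
  have h1 : ‖iteratedFDeriv ℝ n (fun η => σ (R • η)) η‖
      ≤ ‖iteratedFDeriv ℝ n σ (R • η)‖ * R ^ n := by
    have := (R • ContinuousLinearMap.id ℝ E).iteratedFDeriv_comp_right hσ η
      (i := n) (mod_cast le_top)
    have h2 : (σ ∘ ⇑(R • ContinuousLinearMap.id ℝ E)) = fun η => σ (R • η) := rfl
    rw [h2] at this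
    rw [this]
    refine (ContinuousMultilinearMap.norm_compContinuousLinearMap_le _ _).trans ?_
    simp only [Finset.prod_const, Finset.card_univ, Fintype.card_fin]
    have h3 : ‖R • ContinuousLinearMap.id ℝ E‖ ≤ R := by
      rw [norm_smul, Real.norm_of_nonneg hR.le]
      exact mul_le_of_le_one_right hR.le ContinuousLinearMap.norm_id_le
    gcongr
    rfl
  have h4 : (1 + ‖R • η‖ ^ 2) ^ (-(δ + n) / 2 : ℝ) ≤ R ^ (-(δ + n)) := by
    calc (1 + ‖R • η‖ ^ 2) ^ (-(δ + n) / 2 : ℝ) ≤ (R ^ 2) ^ (-(δ + n) / 2 : ℝ) := by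
          apply Real.rpow_le_rpow_of_nonpos (by positivity)
          · rw [norm_smul, Real.norm_of_nonneg hR.le, mul_pow]
            nlinarith [pow_pos hR 2, one_le_pow₀ hη (n := 2)]
          · have : (0 : ℝ) ≤ n := n.cast_nonneg
            linarith
      _ = R ^ (-(δ + n)) := by
          rw [← Real.rpow_natCast, ← Real.rpow_mul hR.le]
          congr 1
          push_cast
          ring
  calc _ ≤ (Cn * R ^ (-(δ + n))) * R ^ n := h1.trans (by gcongr; exact (hbd _).trans (by gcongr))
    _ = Cn * R ^ (-δ) := by
      rw [mul_assoc, ← Real.rpow_natCast, ← Real.rpow_add hR]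
      congr 2
      ring

omit [FiniteDimensional ℝ E] [MeasurableSpace E] [BorelSpace E] in
/-- Schwartz seminorms of the rescaled pieces of a symbol of order `-δ`. -/
theorem exists_seminorm_le_of_annulus {σ : E → ℂ} (hσ : ContDiff ℝ ∞ σ) {δ : ℝ} (hδ : 0 < δ)
    (hbd : ∀ n : ℕ, ∃ Cn : ℝ, ∀ ξ,
      ‖iteratedFDeriv ℝ n σ ξ‖ ≤ Cn * (1 + ‖ξ‖ ^ 2) ^ (-(δ + n) / 2 : ℝ))
    (ψ : 𝓢(E, ℂ)) (hψ : ∀ η, ‖η‖ < 1 → ψ η = 0) (k n : ℕ) :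
    ∃ B : ℝ, 0 ≤ B ∧ ∀ (R : ℝ) (s : 𝓢(E, ℂ)), 0 < R → (∀ η, s η = σ (R • η) * ψ η) →
      SchwartzMap.seminorm ℂ k n s ≤ B * R ^ (-δ) := by
  choose C hC using hbd
  have hC0 : ∀ n, 0 ≤ C n := fun n => by simpa using (norm_nonneg _).trans (hC n 0)
  refine ⟨∑ i ∈ Finset.range (n + 1),
    n.choose i * C i * SchwartzMap.seminorm ℂ k (n - i) ψ, ?_, fun R s hR hs => ?_⟩
  · exact Finset.sum_nonneg fun i _ => mul_nonneg (mul_nonneg (Nat.cast_nonneg _) (hC0 i))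
      (apply_nonneg _ _)
  have hs' : (s : E → ℂ) = fun η => σ (R • η) * ψ η := funext hs
  refine SchwartzMap.seminorm_le_bound _ _ _ _ ?_ fun η => ?_
  · exact mul_nonneg (Finset.sum_nonneg fun i _ => mul_nonneg (mul_nonneg (Nat.cast_nonneg _)
      (hC0 i)) (apply_nonneg _ _)) (Real.rpow_nonneg hR.le _)
  have hmul := norm_iteratedFDeriv_mul_le (𝕜 := ℝ) (N := ∞) (n := n)
    (hσ.comp (contDiff_const_smul R)) (ψ.smooth ⊤) η (mod_cast le_top)
  rw [hs']
  refine (mul_le_mul_of_nonneg_left hmul (by positivity)).trans ?_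
  rw [Finset.mul_sum, Finset.sum_mul]
  refine Finset.sum_le_sum fun i _ => ?_
  rcases lt_or_ge ‖η‖ 1 with h | h
  · have hz : iteratedFDeriv ℝ (n - i) ψ η = 0 := by
      have : (ψ : E → ℂ) =ᶠ[𝓝 η] 0 := by
        filter_upwards [(isOpen_lt continuous_norm continuous_const).mem_nhds h] with y hy
        exact hψ y hy
      simpa using (this.iteratedFDeriv ℝ (n - i)).eq_of_nhds
    rw [hz, norm_zero, mul_zero, mul_zero]
    exact mul_nonneg (mul_nonneg (mul_nonneg (Nat.cast_nonneg _) (hC0 i)) (apply_nonneg _ _))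
      (Real.rpow_nonneg hR.le _)
  · have h1 := norm_iteratedFDeriv_comp_smul_le hσ hδ (hC i) hR h
    have h2 := SchwartzMap.le_seminorm ℂ k (n - i) ψ η
    calc _ = n.choose i * ‖iteratedFDeriv ℝ i (fun η => σ (R • η)) η‖
          * (‖η‖ ^ k * ‖iteratedFDeriv ℝ (n - i) ψ η‖) := by
            simp only [Function.comp_def]; ring
      _ ≤ n.choose i * (C i * R ^ (-δ)) * SchwartzMap.seminorm ℂ k (n - i) ψ := by
            have := hC0 i
            gcongr
      _ = _ := by ring

theorem exists_fourierInvL1Seminorm_le_of_annulus {σ : E → ℂ} (hσ : ContDiff ℝ ∞ σ) {δ : ℝ}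
    (hδ : 0 < δ)
    (hbd : ∀ n : ℕ, ∃ Cn : ℝ, ∀ ξ,
      ‖iteratedFDeriv ℝ n σ ξ‖ ≤ Cn * (1 + ‖ξ‖ ^ 2) ^ (-(δ + n) / 2 : ℝ))
    (ψ : 𝓢(E, ℂ)) (hψ : ∀ η, ‖η‖ < 1 → ψ η = 0) :
    ∃ B : ℝ, 0 ≤ B ∧ ∀ (R : ℝ) (s : 𝓢(E, ℂ)), 0 < R → (∀ η, s η = σ (R • η) * ψ η) →
      fourierInvL1Seminorm E s ≤ B * R ^ (-δ) := by
  obtain ⟨t, C, h⟩ := exists_fourierInvL1Seminorm_le E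
  choose B hB0 hB using fun m : ℕ × ℕ =>
    exists_seminorm_le_of_annulus hσ hδ hbd ψ hψ m.1 m.2
  refine ⟨C * ∑ m ∈ t, B m,
    mul_nonneg C.coe_nonneg (Finset.sum_nonneg fun i _ => hB0 i), fun R s hR hs => (h s).trans ?_⟩
  rw [mul_assoc]
  refine mul_le_mul_of_nonneg_left ?_ C.coe_nonneg
  refine Seminorm.finset_sup_apply_le
    (mul_nonneg (Finset.sum_nonneg fun i _ => hB0 i) (Real.rpow_nonneg hR.le _)) fun m hm => ?_
  refine (hB m R s hR hs).trans ?_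
  have := Real.rpow_nonneg hR.le (-δ)
  gcongr
  exact Finset.single_le_sum (fun i _ => hB0 i) hm

omit [MeasurableSpace E] [BorelSpace E] in
variable (E) in
/-- A smooth cutoff, equal to `1` on the unit ball. -/
theorem exists_smooth_cutoff : ∃ χ : E → ℂ, ContDiff ℝ ∞ χ ∧ HasCompactSupport χ ∧
    (∀ x, ‖x‖ ≤ 1 → χ x = 1) ∧ ∀ x, ‖χ x‖ ≤ 1 := by
  let b : ContDiffBump (0 : E) := ⟨1, 2, one_pos, one_lt_two⟩
  refine ⟨fun x => (b x : ℂ), Complex.ofRealCLM.contDiff.comp b.contDiff,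
    b.hasCompactSupport.comp_left Complex.ofReal_zero, fun x hx => ?_, fun x => ?_⟩
  · beta_reduce
    rw [b.one_of_mem_closedBall (by simpa [b] using hx), Complex.ofReal_one]
  · rw [Complex.norm_real, Real.norm_of_nonneg b.nonneg]
    exact b.le_one

/-- The truncations of a symbol of order `-δ` have kernels uniformly bounded in `L¹`. -/
theorem exists_fourierInvL1Seminorm_truncation_le {σ : E → ℂ} (hσ : ContDiff ℝ ∞ σ) {δ : ℝ}
    (hδ : 0 < δ)
    (hbd : ∀ n : ℕ, ∃ Cn : ℝ, ∀ ξ,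
      ‖iteratedFDeriv ℝ n σ ξ‖ ≤ Cn * (1 + ‖ξ‖ ^ 2) ^ (-(δ + n) / 2 : ℝ))
    {χ : E → ℂ} (hχ : ContDiff ℝ ∞ χ) (hχc : HasCompactSupport χ)
    (hχ1 : ∀ x, ‖x‖ ≤ 1 → χ x = 1) (S : ℕ → 𝓢(E, ℂ))
    (hS : ∀ N ξ, S N ξ = σ ξ * χ (((2 : ℝ) ^ N)⁻¹ • ξ)) :
    ∃ M : ℝ≥0, ∀ N, fourierInvL1Seminorm E (S N) ≤ M := by
  have hψc : HasCompactSupport fun η => χ ((2 : ℝ)⁻¹ • η) - χ η :=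
    (hχc.comp_smul (inv_ne_zero two_ne_zero)).sub hχc
  have hψs : ContDiff ℝ ∞ fun η => χ ((2 : ℝ)⁻¹ • η) - χ η :=
    (hχ.comp (contDiff_const_smul _)).sub hχ
  let ψ : 𝓢(E, ℂ) := hψc.toSchwartzMap hψs
  have hψ : ∀ η, ‖η‖ < 1 → ψ η = 0 := fun η hη => by
    have : ‖(2 : ℝ)⁻¹ • η‖ ≤ 1 := by
      rw [norm_smul, norm_inv, Real.norm_two]
      linarith
    simp [ψ, hχ1 η hη.le, hχ1 _ this]
  obtain ⟨B, hB0, hB⟩ := exists_fourierInvL1Seminorm_le_of_annulus hσ hδ hbd ψ hψ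
  have hdiff : ∀ N, fourierInvL1Seminorm E (S (N + 1) - S N) ≤ B * ((2 : ℝ) ^ (-δ)) ^ N := by
    intro N
    have hR : (0 : ℝ) < 2 ^ N := by positivity
    let s : 𝓢(E, ℂ) := HasCompactSupport.toSchwartzMap
      (f := fun η => σ ((2 : ℝ) ^ N • η) * (χ ((2 : ℝ)⁻¹ • η) - χ η)) hψc.mul_left
      ((hσ.comp (contDiff_const_smul _)).mul hψs)
    have hs : ∀ η, s η = (S (N + 1) - S N) ((2 : ℝ) ^ N • η) := fun η => by
      have h2 : ((2 : ℝ) ^ (N + 1))⁻¹ * 2 ^ N = 2⁻¹ := by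
        field_simp
        ring
      simp [s, hS, smul_smul, h2, mul_sub]
    rw [← fourierInvL1Seminorm_eq_of_comp_smul hR hs]
    refine (hB _ s hR fun η => rfl).trans_eq ?_
    rw [← Real.rpow_natCast, ← Real.rpow_mul zero_le_two, ← Real.rpow_natCast,
      ← Real.rpow_mul zero_le_two, mul_comm (N : ℝ)]
  have hr0 : (0 : ℝ) ≤ 2 ^ (-δ) := by positivity
  have hr1 : (2 : ℝ) ^ (-δ) < 1 := Real.rpow_lt_one_of_one_lt_of_neg one_lt_two (neg_lt_zero.2 hδ)
  have hsum : ∀ N, fourierInvL1Seminorm E (S N)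
      ≤ fourierInvL1Seminorm E (S 0) + ∑ j ∈ Finset.range N, B * ((2 : ℝ) ^ (-δ)) ^ j := by
    intro N
    induction N with
    | zero => simp
    | succ N ih =>
      have := map_add_le_add (fourierInvL1Seminorm E) (S N) (S (N + 1) - S N)
      rw [add_sub_cancel] at this
      rw [Finset.sum_range_succ]
      linarith [hdiff N]
  refine ⟨(fourierInvL1Seminorm E (S 0) + ∑' j, B * ((2 : ℝ) ^ (-δ)) ^ j).toNNReal,
    fun N => (hsum N).trans (le_trans ?_ (Real.le_coe_toNNReal _))⟩
  gcongr
  exact ((summable_geometric_of_lt_one hr0 hr1).mul_left B).sum_le_tsum _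
    fun j _ => mul_nonneg hB0 (pow_nonneg hr0 j)

/-- A Fourier multiplier with symbol of order `-δ < 0` is bounded on every `L^p`. -/
theorem exists_eLpNorm_fourierMultiplier_le {σ : E → ℂ} (hσ : ContDiff ℝ ∞ σ) {δ : ℝ}
    (hδ : 0 < δ)
    (hbd : ∀ n : ℕ, ∃ Cn : ℝ, ∀ ξ,
      ‖iteratedFDeriv ℝ n σ ξ‖ ≤ Cn * (1 + ‖ξ‖ ^ 2) ^ (-(δ + n) / 2 : ℝ)) :
    ∃ C : ℝ≥0, ∀ p : ℝ≥0∞, 1 ≤ p → ∀ f : 𝓢(E, ℂ),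
      eLpNorm (𝓕⁻ (fun ξ => σ ξ * 𝓕 (⇑f) ξ)) p volume ≤ C * eLpNorm f p volume := by
  obtain ⟨χ, hχ, hχc, hχ1, hχle⟩ := exists_smooth_cutoff E
  let S : ℕ → 𝓢(E, ℂ) := fun N => HasCompactSupport.toSchwartzMap
    (f := fun ξ => σ ξ * χ (((2 : ℝ) ^ N)⁻¹ • ξ))
    (hχc.comp_smul (inv_ne_zero (by positivity))).mul_left
    (hσ.mul (hχ.comp (contDiff_const_smul _)))
  obtain ⟨M, hM⟩ := exists_fourierInvL1Seminorm_truncation_le hσ hδ hbd hχ hχc hχ1 S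
    fun _ _ => rfl
  have hσle : ∃ A : ℝ, ∀ ξ, ‖σ ξ‖ ≤ A := by
    obtain ⟨A, hA⟩ := hbd 0
    have hA0 : 0 ≤ A := by simpa using (norm_nonneg _).trans (hA 0)
    refine ⟨A, fun ξ => ?_⟩
    rw [← norm_iteratedFDeriv_zero (𝕜 := ℝ)]
    refine (hA ξ).trans (mul_le_of_le_one_right hA0 ?_)
    refine Real.rpow_le_one_of_one_le_of_nonpos (by nlinarith [sq_nonneg ‖ξ‖]) ?_
    push_cast
    linarith
  obtain ⟨A, hA⟩ := hσle
  refine ⟨M, fun p hp f => ?_⟩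
  have hbound : ∀ N, eLpNorm (𝓕⁻ (fun ξ => S N ξ * 𝓕 (⇑f) ξ)) p volume
      ≤ M * eLpNorm f p volume := fun N => by
    refine (eLpNorm_fourierInv_mul_le (S N) f hp).trans ?_
    gcongr
    rw [← ofReal_fourierInvL1Seminorm, ← ENNReal.ofReal_coe_nnreal]
    exact ENNReal.ofReal_le_ofReal (hM N)
  have hFf : Integrable (𝓕 (⇑f)) := (𝓕 f).integrable
  have hmeas : ∀ N, AEStronglyMeasurable (𝓕⁻ (fun ξ => S N ξ * 𝓕 (⇑f) ξ)) volume := fun N => by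
    have : (fun ξ => S N ξ * 𝓕 (⇑f) ξ)
        = ⇑(SchwartzMap.pairing (ContinuousLinearMap.mul ℂ ℂ) (S N) (𝓕 f)) := by
      ext ξ
      simp [SchwartzMap.fourier_coe]
    rw [this, ← SchwartzMap.fourierInv_coe]
    exact (SchwartzMap.continuous _).aestronglyMeasurable
  have hlim : ∀ x, Tendsto (fun N => 𝓕⁻ (fun ξ => S N ξ * 𝓕 (⇑f) ξ) x) atTop
      (𝓝 (𝓕⁻ (fun ξ => σ ξ * 𝓕 (⇑f) ξ) x)) := by
    intro x
    simp_rw [Real.fourierInv_eq]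
    refine tendsto_integral_of_dominated_convergence (fun ξ => A * ‖𝓕 (⇑f) ξ‖) (fun N => ?_)
      (hFf.norm.const_mul A) (fun N => ae_of_all _ fun ξ => ?_) (ae_of_all _ fun ξ => ?_)
    · have h1 : Continuous fun ξ => 𝓕 (⇑f) ξ := (𝓕 f).continuous
      have h2 := (S N).continuous
      refine Continuous.aestronglyMeasurable ?_
      fun_prop
    · rw [Circle.norm_smul, norm_mul]
      gcongr
      exact (norm_mul_le _ _).trans
        ((mul_le_of_le_one_right (norm_nonneg _) (hχle _)).trans (hA ξ))
    · refine tendsto_const_nhds.congr' ?_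
      obtain ⟨N₀, hN₀⟩ := pow_unbounded_of_one_lt ‖ξ‖ (one_lt_two (α := ℝ))
      filter_upwards [eventually_ge_atTop N₀] with N hN
      have : ‖((2 : ℝ) ^ N)⁻¹ • ξ‖ ≤ 1 := by
        rw [norm_smul, norm_inv, norm_pow, Real.norm_two, inv_mul_le_one₀ (by positivity)]
        exact hN₀.le.trans (pow_le_pow_right₀ one_le_two hN)
      simp [S, hχ1 _ this]
  refine (Lp.eLpNorm_lim_le_liminf_eLpNorm hmeas _ (ae_of_all _ hlim)).trans ?_
  exact (liminf_le_liminf (Eventually.of_forall hbound)).trans_eq (by simp)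

/-- a smooth symbol `σ` on `ℝ^d` with `|∂^α σ(ξ)| ≤ C_α ⟨ξ⟩^{−δ−|α|}`
(`δ > 0`) defines a Fourier multiplier `σ(i∂) f = 𝓕⁻(σ · 𝓕f)` which is bounded on
`L^p` for every `p ∈ [1,∞]`, uniformly over Schwartz functions. -/
theorem stmt10 (d : ℕ) (hd : 1 ≤ d) (δ : ℝ) (hδ : 0 < δ)
    (σ : EuclideanSpace ℝ (Fin d) → ℂ) (hσsmooth : ContDiff ℝ (⊤ : ℕ∞) σ)
    (hσbd : ∀ n : ℕ, ∃ Cn : ℝ, ∀ ξ,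
      ‖iteratedFDeriv ℝ n σ ξ‖ ≤ Cn * (1 + ‖ξ‖ ^ 2) ^ (-(δ + n) / 2 : ℝ))
    (p : ℝ≥0∞) (hp : 1 ≤ p) :
    ∃ C : ℝ≥0, ∀ f : SchwartzMap (EuclideanSpace ℝ (Fin d)) ℂ,
      eLpNorm (𝓕⁻ (fun ξ => σ ξ * 𝓕 (⇑f) ξ)) p volume ≤ C * eLpNorm (⇑f) p volume := by
  obtain ⟨C, hC⟩ := exists_eLpNorm_fourierMultiplier_le hσsmooth hδ hσbd
  exact ⟨C, hC p hp⟩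
end
end

section
/- Let d ≥ 1 and δ > 0, and let σ : ℝ^d → ℂ be smooth with |∂^α σ(ξ)| ≤ C_α ⟨ξ⟩^{−δ−|α|} for every multi-index α, where ⟨ξ⟩ = √(1+|ξ|²). Then for every p ∈ [1,∞] there is a constant C such that for every Schwartz function f : ℝ^d → ℂ and every coordinate j ∈ {1,…,d}, ‖F⁻¹(σ(ξ) · iξ_j · f̂)‖_{L^p(ℝ^d)} ≤ C ‖f‖_{L^p}^{δ/(1+δ)} ‖ |∇f| ‖_{L^p}^{1/(1+δ)}; in particular this quantity is bounded by C times the W^{1,p} norm of f. -/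
noncomputable section
open MeasureTheory
open scoped FourierTransform ENNReal NNReal


/-- **Young's convolution inequality** `L¹ * Lᵖ ⊆ Lᵖ`, for `ℝ≥0∞`-valued functions. -/
theorem lintegral_rpow_lintegral_mul_sub_le {E : Type*} [NormedAddCommGroup E] [InnerProductSpace ℝ E]
    [FiniteDimensional ℝ E] [MeasurableSpace E] [BorelSpace E] {k h : E → ℝ≥0∞}
    (hk : Measurable k) (hh : Measurable h) {p : ℝ} (hp : 1 ≤ p) :
    (∫⁻ x, (∫⁻ t, k t * h (x - t)) ^ p) ^ (1 / p) ≤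
      (∫⁻ t, k t) * (∫⁻ x, h x ^ p) ^ (1 / p) := by
  have hp0 : 0 < p := zero_lt_one.trans_le hp
  set A := ∫⁻ t, k t with hA
  have key : ∀ x, (∫⁻ t, k t * h (x - t)) ^ p ≤
      A ^ (p - 1) * ∫⁻ t, k t * h (x - t) ^ p := by
    intro x
    have hm : Measurable fun t => h (x - t) := hh.comp (measurable_const.sub measurable_id)
    have h1 := eLpNorm'_le_eLpNorm'_mul_rpow_measure_univ (μ := volume.withDensity k)
      (f := fun t => h (x - t)) zero_lt_one hp hm.aestronglyMeasurable
    simp only [eLpNorm'_eq_lintegral_enorm, enorm_eq_self, ENNReal.rpow_one, div_one] at h1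
    rw [lintegral_withDensity_eq_lintegral_mul _ hk hm,
      lintegral_withDensity_eq_lintegral_mul _ hk (hm.pow_const p),
      withDensity_apply _ MeasurableSet.univ, Measure.restrict_univ, ← hA] at h1
    calc (∫⁻ t, k t * h (x - t)) ^ p
        ≤ ((∫⁻ t, k t * h (x - t) ^ p) ^ (1 / p) * A ^ (1 - 1 / p)) ^ p := by
          gcongr; exact h1
      _ = _ := by
          rw [ENNReal.mul_rpow_of_nonneg _ _ hp0.le, ← ENNReal.rpow_mul, ← ENNReal.rpow_mul,
            one_div_mul_cancel hp0.ne', ENNReal.rpow_one, sub_mul, one_div_mul_cancel hp0.ne',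
            one_mul, mul_comm]
  have hmeas : Measurable fun z : E × E => k z.2 * h (z.1 - z.2) ^ p :=
    (hk.comp measurable_snd).mul ((hh.comp (measurable_fst.sub measurable_snd)).pow_const p)
  have swap : ∫⁻ x, ∫⁻ t, k t * h (x - t) ^ p = A * ∫⁻ x, h x ^ p := by
    rw [lintegral_lintegral_swap hmeas.aemeasurable]
    have : ∀ t, ∫⁻ x, k t * h (x - t) ^ p = k t * ∫⁻ x, h x ^ p := fun t => by
      have hm : Measurable fun x => h (x - t) ^ p :=
        (hh.comp (measurable_id.sub measurable_const)).pow_const p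
      rw [lintegral_const_mul _ hm, lintegral_sub_right_eq_self (fun x => h x ^ p) t]
    simp_rw [this]
    rw [lintegral_mul_const _ hk]
  calc (∫⁻ x, (∫⁻ t, k t * h (x - t)) ^ p) ^ (1 / p)
      ≤ (∫⁻ x, A ^ (p - 1) * ∫⁻ t, k t * h (x - t) ^ p) ^ (1 / p) := by
        gcongr with x; exact key x
    _ = (A ^ p * ∫⁻ x, h x ^ p) ^ (1 / p) := by
        rw [lintegral_const_mul _ hmeas.lintegral_prod_right', swap, ← mul_assoc]
        congr 2
        nth_rewrite 2 [← ENNReal.rpow_one A]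
        rw [← ENNReal.rpow_add_of_nonneg _ _ (by linarith) zero_le_one, sub_add_cancel]
    _ = _ := by
        rw [ENNReal.mul_rpow_of_nonneg _ _ (by positivity), ← ENNReal.rpow_mul,
          mul_one_div_cancel hp0.ne', ENNReal.rpow_one]

open scoped Convolution in
/-- **Young's convolution inequality** `L¹ * Lᵖ ⊆ Lᵖ`. -/
theorem eLpNorm_convolution_mul_le {E : Type*} [NormedAddCommGroup E] [InnerProductSpace ℝ E]
    [FiniteDimensional ℝ E] [MeasurableSpace E] [BorelSpace E] {K g : E → ℂ}
    (hK : Continuous K) (hg : Continuous g) {p : ℝ≥0∞} (hp : 1 ≤ p) :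
    eLpNorm (K ⋆[ContinuousLinearMap.mul ℂ ℂ] g) p volume ≤
      eLpNorm K 1 volume * eLpNorm g p volume := by
  have hpt : ∀ x, ‖(K ⋆[ContinuousLinearMap.mul ℂ ℂ] g) x‖ₑ ≤ ∫⁻ t, ‖K t‖ₑ * ‖g (x - t)‖ₑ := by
    intro x
    refine (enorm_integral_le_lintegral_enorm _).trans_eq ?_
    simp
  rw [eLpNorm_one_eq_lintegral_enorm]
  rcases eq_or_ne p ∞ with rfl | hp_top
  · simp only [eLpNorm_exponent_top]
    refine essSup_le_of_ae_le _ (Filter.Eventually.of_forall fun x => (hpt x).trans ?_)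
    rw [← lintegral_mul_const _ hK.enorm.measurable]
    refine lintegral_mono_ae ?_
    have h1 : ∀ᵐ y, ‖g y‖ₑ ≤ eLpNormEssSup g volume := ae_le_eLpNormEssSup
    have h2 := (Measure.measurePreserving_sub_left volume x).quasiMeasurePreserving.ae h1
    filter_upwards [h2] with t ht
    gcongr
  · have hp0 : p ≠ 0 := (zero_lt_one.trans_le hp).ne'
    rw [eLpNorm_eq_lintegral_rpow_enorm_toReal hp0 hp_top,
      eLpNorm_eq_lintegral_rpow_enorm_toReal hp0 hp_top]
    refine le_trans ?_ (lintegral_rpow_lintegral_mul_sub_le hK.enorm.measurable hg.enorm.measurable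
      (by simpa using ENNReal.toReal_mono hp_top hp))
    gcongr with x
    exact hpt x

section Multiplier

open scoped SchwartzMap

variable {E : Type*} [NormedAddCommGroup E] [InnerProductSpace ℝ E]
    [FiniteDimensional ℝ E] [MeasurableSpace E] [BorelSpace E]

open scoped Convolution in
/-- A Fourier multiplier with Schwartz symbol is bounded on `Lᵖ` by the `L¹` norm of its kernel. -/
theorem SchwartzMap.eLpNorm_fourierInv_mul_fourier_le (M f : 𝓢(E, ℂ)) {p : ℝ≥0∞} (hp : 1 ≤ p) :
    eLpNorm (𝓕⁻ (fun ξ => M ξ * 𝓕 (⇑f) ξ)) p volume ≤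
      eLpNorm (⇑(𝓕⁻ M : 𝓢(E, ℂ))) 1 volume * eLpNorm f p volume := by
  have h : 𝓕⁻ (fun ξ => M ξ * 𝓕 (⇑f) ξ) =
      (⇑(𝓕⁻ M : 𝓢(E, ℂ)) ⋆[ContinuousLinearMap.mul ℂ ℂ] ⇑f) := by
    ext x
    rw [← SchwartzMap.convolution_apply, SchwartzMap.convolution]
    simp only [LinearMap.coe_mk, AddHom.coe_mk, ContinuousLinearMap.comp_apply,
      FourierTransform.fourierCLM_apply, FourierTransform.fourierInvCLM_apply,
      FourierTransform.fourier_fourierInv_eq]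
    rw [SchwartzMap.fourierInv_coe]
    rfl
  rw [h]
  exact eLpNorm_convolution_mul_le (𝓕⁻ M : 𝓢(E, ℂ)).continuous f.continuous hp

/-- The `L¹` norm of the kernel of a multiplier is invariant under dilations of the symbol. -/
theorem eLpNorm_one_fourierInv_comp_smul (m : E → ℂ) {c : ℝ} (hc : 0 < c) :
    eLpNorm (𝓕⁻ (fun ξ => m (c • ξ))) 1 volume = eLpNorm (𝓕⁻ m) 1 volume := by
  have h : ∀ x, 𝓕⁻ (fun ξ => m (c • ξ)) x =
      |(c ^ Module.finrank ℝ E)⁻¹| • 𝓕⁻ m (c⁻¹ • x) := by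
    intro x
    rw [Real.fourierInv_eq, Real.fourierInv_eq, ← Measure.integral_comp_smul]
    congr 1 with ξ
    rw [inner_smul_left, inner_smul_right]
    simp [hc.ne']
  have h2 : ∫⁻ x, ‖𝓕⁻ m (c⁻¹ • x)‖ₑ =
      ENNReal.ofReal |((c⁻¹ ^ Module.finrank ℝ E))⁻¹| * ∫⁻ x, ‖𝓕⁻ m x‖ₑ := by
    rw [← smul_eq_mul, ← lintegral_smul_measure,
      ← Measure.map_addHaar_smul volume (inv_ne_zero hc.ne')]
    exact (lintegral_map_equiv (fun x => ‖𝓕⁻ m x‖ₑ)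
      (Homeomorph.smulOfNeZero _ (inv_ne_zero hc.ne')).toMeasurableEquiv).symm
  simp only [eLpNorm_one_eq_lintegral_enorm, h, enorm_smul]
  rw [lintegral_const_mul' _ _ enorm_ne_top, h2, ← mul_assoc, Real.enorm_eq_ofReal_abs,
    ← ENNReal.ofReal_mul (abs_nonneg _), abs_abs, ← abs_mul]
  have : (c ^ Module.finrank ℝ E)⁻¹ * (c⁻¹ ^ Module.finrank ℝ E)⁻¹ = 1 := by
    rw [inv_pow, inv_inv, inv_mul_cancel₀ (by positivity)]
  rw [this, abs_one, ENNReal.ofReal_one, one_mul]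

end Multiplier

section Symbol

open scoped SchwartzMap

variable {E : Type*} [NormedAddCommGroup E] [InnerProductSpace ℝ E]

/-- A continuous linear map on Schwartz space is bounded on functions with a common compact support
by their derivatives. -/
theorem SchwartzMap.exists_norm_map_le {ι G : Type*} [NormedAddCommGroup G] [NormedSpace ℂ G]
    (L : 𝓢(E, ℂ) →L[ℂ] G) (m : ι → 𝓢(E, ℂ)) (a : ι → ℝ) (R : ℝ)
    (hsupp : ∀ k, tsupport (m k) ⊆ Metric.closedBall 0 R)
    (hm : ∀ n : ℕ, ∃ B : ℝ, ∀ k ξ, ‖iteratedFDeriv ℝ n (m k) ξ‖ ≤ B * a k) :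
    ∃ C : ℝ, ∀ k, ‖L (m k)‖ ≤ C * a k := by
  obtain ⟨s, C, -, hC⟩ := Seminorm.bound_of_continuous (schwartz_withSeminorms ℂ E ℂ)
    ((normSeminorm ℂ G).comp L.toLinearMap) (continuous_norm.comp L.continuous)
  choose B hB using hm
  refine ⟨C * ∑ i ∈ s, |R| ^ i.1 * B i.2, fun k => ?_⟩
  calc ‖L (m k)‖ ≤ C * (s.sup (schwartzSeminormFamily ℂ E ℂ)) (m k) := hC (m k)
    _ ≤ C * ∑ i ∈ s, schwartzSeminormFamily ℂ E ℂ i (m k) := by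
        gcongr
        simpa using Seminorm.finset_sup_le_sum (schwartzSeminormFamily ℂ E ℂ) s (m k)
    _ ≤ C * ∑ i ∈ s, |R| ^ i.1 * (B i.2 * a k) := by
        gcongr with i hi
        have hpos : 0 ≤ B i.2 * a k := (norm_nonneg _).trans (hB i.2 k 0)
        refine SchwartzMap.seminorm_le_bound ℂ _ _ _ (by positivity) fun ξ => ?_
        by_cases hξ : ξ ∈ tsupport (m k)
        · gcongr
          · exact (mem_closedBall_zero_iff.1 (hsupp k hξ)).trans (le_abs_self R)
          · exact hB i.2 k ξ
        · have : iteratedFDeriv ℝ i.2 (m k) ξ = 0 := by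
            by_contra h
            exact hξ (support_iteratedFDeriv_subset i.2 h)
          rw [this, norm_zero, mul_zero]
          positivity
    _ = _ := by
        rw [mul_assoc, Finset.sum_mul]
        simp only [mul_assoc]

/-- Dyadic pieces of a symbol of order `-δ`, rescaled to unit frequency, are `O(2^{-kδ})` together
with all their derivatives. -/
theorem exists_norm_iteratedFDeriv_dilate_mul_le {σ ψ : E → ℂ} {δ : ℝ} (hδ : 0 < δ)
    (hσ : ContDiff ℝ (⊤ : ℕ∞) σ)
    (hσbd : ∀ n : ℕ, ∃ Cn : ℝ, ∀ ξ,
      ‖iteratedFDeriv ℝ n σ ξ‖ ≤ Cn * (1 + ‖ξ‖ ^ 2) ^ (-(δ + n) / 2 : ℝ))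
    (hψ : ContDiff ℝ (⊤ : ℕ∞) ψ) (hψc : HasCompactSupport ψ)
    (hψ1 : ∀ ξ ∈ tsupport ψ, 1 ≤ ‖ξ‖) (n : ℕ) :
    ∃ B : ℝ, ∀ (k : ℕ) (ξ : E),
      ‖iteratedFDeriv ℝ n (fun ξ => σ ((2 : ℝ) ^ k • ξ) * ψ ξ) ξ‖ ≤ B * ((2 : ℝ) ^ (-δ)) ^ k := by
  choose C hC using hσbd
  have hD : ∀ m : ℕ, ∃ D : ℝ, ∀ ξ, ‖iteratedFDeriv ℝ m ψ ξ‖ ≤ D := fun m =>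
    ⟨_, SchwartzMap.norm_iteratedFDeriv_le_seminorm ℝ (hψc.toSchwartzMap hψ) m⟩
  choose D hD using hD
  have hD0 : ∀ m, 0 ≤ D m := fun m => (norm_nonneg _).trans (hD m 0)
  refine ⟨∑ i ∈ Finset.range (n + 1), n.choose i * |C i| * D (n - i), fun k ξ => ?_⟩
  have hσk : ContDiff ℝ (⊤ : ℕ∞) fun ξ => σ ((2 : ℝ) ^ k • ξ) := by fun_prop
  by_cases hξ : ξ ∈ tsupport ψ
  · have hσi : ∀ i : ℕ, ‖iteratedFDeriv ℝ i (fun ξ => σ ((2 : ℝ) ^ k • ξ)) ξ‖ ≤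
        |C i| * ((2 : ℝ) ^ (-δ)) ^ k := by
      intro i
      have h2 : (0 : ℝ) < 2 ^ k := by positivity
      rw [iteratedFDeriv_comp_const_smul _ (hσ.of_le (by exact_mod_cast le_top)), norm_smul, norm_pow,
        Real.norm_of_nonneg h2.le]
      have hb : (1 + ‖(2 : ℝ) ^ k • ξ‖ ^ 2) ^ (-(δ + i) / 2 : ℝ) ≤
          (((2 : ℝ) ^ k) ^ 2) ^ (-(δ + i) / 2 : ℝ) := by
        refine Real.rpow_le_rpow_of_nonpos (by positivity) ?_
          (by have : (0 : ℝ) ≤ i := i.cast_nonneg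
              linarith)
        rw [norm_smul, Real.norm_of_nonneg h2.le, mul_pow]
        nlinarith [one_le_pow₀ (hψ1 ξ hξ) (n := 2), sq_nonneg ((2 : ℝ) ^ k)]
      have he : (((2 : ℝ) ^ k) ^ 2) ^ (-(δ + i) / 2 : ℝ) =
          ((2 : ℝ) ^ (-δ)) ^ k * (((2 : ℝ) ^ k) ^ i)⁻¹ := by
        rw [← Real.rpow_natCast_mul h2.le, ← Real.rpow_natCast, ← Real.rpow_natCast (_ ^ (k : ℝ)),
          ← Real.rpow_neg (by positivity), ← Real.rpow_mul (by positivity),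
          ← Real.rpow_mul (by positivity), ← Real.rpow_natCast, ← Real.rpow_mul (by positivity),
          ← Real.rpow_add (by positivity)]
        congr 1
        push_cast
        ring
      calc ((2 : ℝ) ^ k) ^ i * ‖iteratedFDeriv ℝ i σ ((2 : ℝ) ^ k • ξ)‖
          ≤ ((2 : ℝ) ^ k) ^ i * (|C i| * (((2 : ℝ) ^ k) ^ 2) ^ (-(δ + i) / 2 : ℝ)) := by
            gcongr
            refine (hC i _).trans ?_
            gcongr
            exact le_abs_self _
        _ = _ := by
            rw [he]
            field_simp
    calc _ ≤ _ := norm_iteratedFDeriv_mul_le hσk hψ ξ (by exact_mod_cast le_top)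
      _ ≤ ∑ i ∈ Finset.range (n + 1), n.choose i * (|C i| * ((2 : ℝ) ^ (-δ)) ^ k) * D (n - i) := by
          gcongr with i hi
          · exact hσi i
          · exact hD _ ξ
      _ = _ := by
          rw [Finset.sum_mul]
          exact Finset.sum_congr rfl fun i _ => by ring
  · have : iteratedFDeriv ℝ n (fun ξ => σ ((2 : ℝ) ^ k • ξ) * ψ ξ) ξ = 0 := by
      by_contra h
      exact hξ (tsupport_mul_subset_right (support_iteratedFDeriv_subset n h))
    rw [this, norm_zero]
    have := Finset.sum_nonneg (s := Finset.range (n + 1))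
      (f := fun i => n.choose i * |C i| * D (n - i)) fun i _ =>
        mul_nonneg (by positivity) (hD0 _)
    positivity

end Symbol

/-- Optimising a two-parameter bound over dyadic thresholds. -/
theorem le_rpow_mul_rpow_of_forall_nat {x F G C δ : ℝ} (hδ : 0 < δ) (hF : 0 ≤ F) (hG : 0 ≤ G)
    (hC : 0 ≤ C) (h0 : x ≤ C * G)
    (h : ∀ N : ℕ, x ≤ C * (2 ^ N * F + ((2 : ℝ) ^ (-δ)) ^ N * G)) :
    x ≤ 3 * C * F ^ (δ / (1 + δ)) * G ^ (1 / (1 + δ)) := by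
  have hs : δ / (1 + δ) + 1 / (1 + δ) = 1 := by field_simp; ring
  have hδ' : 0 < 1 + δ := by linarith
  rcases le_or_gt G F with hGF | hFG
  · calc x ≤ C * G := h0
      _ = C * (G ^ (δ / (1 + δ)) * G ^ (1 / (1 + δ))) := by
          rw [← Real.rpow_add_of_nonneg hG (by positivity) (by positivity), hs, Real.rpow_one]
      _ ≤ C * (F ^ (δ / (1 + δ)) * G ^ (1 / (1 + δ))) := by gcongr
      _ ≤ _ := by
          have : 0 ≤ C * (F ^ (δ / (1 + δ)) * G ^ (1 / (1 + δ))) := by positivity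
          linarith
  rcases hF.eq_or_lt with rfl | hF
  · rw [Real.zero_rpow (by positivity), mul_zero, zero_mul]
    have hr : Filter.Tendsto (fun N : ℕ => C * (2 ^ N * 0 + ((2 : ℝ) ^ (-δ)) ^ N * G))
        Filter.atTop (nhds 0) := by
      have := (tendsto_pow_atTop_nhds_zero_of_lt_one (r := (2 : ℝ) ^ (-δ)) (by positivity)
        (Real.rpow_lt_one_of_one_lt_of_neg one_lt_two (by linarith))).mul_const (C * G)
      simpa [mul_assoc, mul_left_comm, mul_comm] using this
    exact ge_of_tendsto' hr h
  have hG : 0 < G := hF.trans hFG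
  set y := (G / F) ^ (1 / (1 + δ)) with hy
  have hy0 : 0 < y := by positivity
  have hy1 : 1 ≤ y := Real.one_le_rpow ((one_le_div hF).2 hFG.le) (by positivity)
  obtain ⟨n, hn, hn'⟩ := exists_nat_pow_near hy1 one_lt_two
  have hyF : y * F = F ^ (δ / (1 + δ)) * G ^ (1 / (1 + δ)) := by
    rw [hy, Real.div_rpow hG.le hF.le, div_mul_eq_mul_div, div_eq_iff (by positivity), mul_right_comm,
      ← Real.rpow_add hF, hs, Real.rpow_one, mul_comm]
  have hyG : y ^ (-δ) * G = F ^ (δ / (1 + δ)) * G ^ (1 / (1 + δ)) := by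
    have : 1 / (1 + δ) * -δ = -(δ / (1 + δ)) := by ring
    rw [hy, ← Real.rpow_mul (by positivity), this, Real.rpow_neg (by positivity),
      Real.div_rpow hG.le hF.le, inv_div, div_mul_eq_mul_div, div_eq_iff (by positivity), mul_assoc,
      ← Real.rpow_add hG, add_comm (1 / (1 + δ)), hs, Real.rpow_one]
  have hr : ((2 : ℝ) ^ (-δ)) ^ (n + 1) ≤ y ^ (-δ) := by
    rw [← Real.rpow_natCast, ← Real.rpow_mul zero_le_two, mul_comm, Real.rpow_mul zero_le_two,
      Real.rpow_natCast]
    exact Real.rpow_le_rpow_of_nonpos hy0 hn'.le (by linarith)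
  calc x ≤ C * (2 ^ (n + 1) * F + ((2 : ℝ) ^ (-δ)) ^ (n + 1) * G) := h _
    _ ≤ C * (2 * y * F + y ^ (-δ) * G) := by
        gcongr
        rw [pow_succ']
        gcongr
    _ = _ := by rw [mul_assoc 2, hyG, hyF]; ring

/-- Summation of dyadic pieces obeying both a growing and a decaying bound. -/
theorem le_rpow_mul_rpow_of_le_tsum {X a : ℝ≥0∞} {b : ℕ → ℝ≥0∞} {F G C : ℝ≥0} {δ : ℝ} (hδ : 0 < δ)
    (hX : X ≤ a + ∑' k, b k) (haF : a ≤ C * F) (haG : a ≤ C * G)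
    (hbF : ∀ k, b k ≤ C * 2 ^ k * F) (hbG : ∀ k, b k ≤ C * (((2 : ℝ≥0) ^ (-δ) : ℝ≥0) : ℝ≥0∞) ^ k * G) :
    X ≤ (C * (1 + (1 - (2 : ℝ≥0) ^ (-δ))⁻¹) : ℝ≥0) * G ∧
    X ≤ (3 * (C * (1 + (1 - (2 : ℝ≥0) ^ (-δ))⁻¹)) : ℝ≥0) * (F : ℝ≥0∞) ^ (δ / (1 + δ)) *
      (G : ℝ≥0∞) ^ (1 / (1 + δ)) := by
  set r : ℝ≥0 := (2 : ℝ≥0) ^ (-δ) with hr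
  have hr1 : r < 1 := NNReal.rpow_lt_one_of_one_lt_of_neg one_lt_two (by linarith)
  have hgeom : ∑' k : ℕ, (r : ℝ≥0∞) ^ k = ((1 - r)⁻¹ : ℝ≥0) := by
    rw [ENNReal.tsum_geometric, ENNReal.coe_inv (tsub_pos_of_lt hr1).ne']
    simp
  set S : ℝ≥0 := (1 - r)⁻¹ with hS
  have h0 : X ≤ (C * (1 + S) : ℝ≥0) * G := by
    calc X ≤ C * G + ∑' k, C * (r : ℝ≥0∞) ^ k * G := hX.trans (by gcongr; exact hbG _)
      _ = _ := by
        rw [ENNReal.tsum_mul_right, ENNReal.tsum_mul_left, hgeom]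
        push_cast
        ring
  refine ⟨h0, ?_⟩
  have hN : ∀ N : ℕ, X ≤ (C * (1 + S) : ℝ≥0) * (2 ^ N * F + (r : ℝ≥0∞) ^ N * G) := by
    intro N
    have h1 : a + ∑ k ∈ Finset.range N, b k ≤ C * (2 ^ N * F) := by
      induction N with
      | zero => simpa using haF
      | succ N ih =>
        rw [Finset.sum_range_succ, ← add_assoc]
        exact (add_le_add ih (hbF N)).trans_eq (by ring)
    have h2 : ∑' k, b (k + N) ≤ C * S * ((r : ℝ≥0∞) ^ N * G) := by
      calc _ ≤ ∑' k, (r : ℝ≥0∞) ^ k * (C * (r : ℝ≥0∞) ^ N * G) :=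
            ENNReal.tsum_le_tsum fun k => (hbG _).trans_eq (by rw [pow_add]; ring)
        _ = _ := by rw [ENNReal.tsum_mul_right, hgeom]; ring
    calc X ≤ a + (∑ k ∈ Finset.range N, b k + ∑' k, b (k + N)) := by
          rwa [ENNReal.summable.sum_add_tsum_nat_add']
      _ ≤ C * (2 ^ N * F) + C * S * ((r : ℝ≥0∞) ^ N * G) := by
          rw [← add_assoc]; exact add_le_add h1 h2
      _ ≤ (C * (1 + S)) * (2 ^ N * F) + (C * (1 + S)) * ((r : ℝ≥0∞) ^ N * G) := by
          gcongr
          · exact le_mul_of_one_le_right' (le_add_right le_rfl)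
          · exact le_add_left le_rfl
      _ = _ := by push_cast; ring
  have hXtop : X ≠ ∞ := ne_top_of_le_ne_top (by finiteness) h0
  lift X to ℝ≥0 using hXtop
  rw [← ENNReal.coe_rpow_of_nonneg _ (by positivity), ← ENNReal.coe_rpow_of_nonneg _ (by positivity)]
  norm_cast at h0 hN ⊢
  rw [← NNReal.coe_le_coe] at h0 ⊢
  have := le_rpow_mul_rpow_of_forall_nat (x := X) (F := F) (G := G) (C := (C * (1 + S) : ℝ≥0)) hδ
    F.2 G.2 (NNReal.coe_nonneg _) (by exact_mod_cast h0) fun N => by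
      have := NNReal.coe_le_coe.2 (hN N)
      simpa [hr] using this
  simpa using this

section DyadicSum

open scoped SchwartzMap LineDeriv

variable {E : Type*} [NormedAddCommGroup E] [InnerProductSpace ℝ E]

/-- The symbol `i⟨ξ, v⟩` of a directional derivative. -/
def dirSymbol (v ξ : E) : ℂ := Complex.I * ((inner ℝ ξ v : ℝ) : ℂ)

theorem hasTemperateGrowth_dirSymbol (v : E) : (dirSymbol v).HasTemperateGrowth := by
  unfold dirSymbol
  fun_prop

variable [FiniteDimensional ℝ E] [MeasurableSpace E] [BorelSpace E]

/-- The `L¹` class of the convolution kernel of the multiplier with a given Schwartz symbol. -/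
def kernelL1 : 𝓢(E, ℂ) →L[ℂ] Lp ℂ 1 (volume : Measure E) :=
  SchwartzMap.toLpCLM ℂ ℂ 1 volume ∘L FourierTransform.fourierInvCLM ℂ 𝓢(E, ℂ)

theorem enorm_kernelL1 (M : 𝓢(E, ℂ)) :
    ‖kernelL1 M‖ₑ = eLpNorm (⇑(𝓕⁻ M : 𝓢(E, ℂ))) 1 volume := by
  rw [Lp.enorm_def]
  exact eLpNorm_congr_ae (SchwartzMap.coeFn_toLp _ 1 volume)

theorem enorm_kernelL1_eq_of_dilate {M m : 𝓢(E, ℂ)} {c : ℝ} (hc : 0 < c)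
    (h : ∀ ξ, M ξ = m (c • ξ)) : ‖kernelL1 M‖ₑ = ‖kernelL1 m‖ₑ := by
  rw [enorm_kernelL1, enorm_kernelL1, SchwartzMap.fourierInv_coe, SchwartzMap.fourierInv_coe,
    ← eLpNorm_one_fourierInv_comp_smul m hc]
  congr 2
  ext ξ
  exact h ξ

/-- The function with Fourier transform `M(ξ) i⟨ξ, v⟩ f̂(ξ)`, as a function of the symbol `M`. -/
def dirMultiplier (v : E) (f : 𝓢(E, ℂ)) : 𝓢(E, ℂ) →L[ℂ] 𝓢(E, ℂ) :=
  FourierTransform.fourierInvCLM ℂ 𝓢(E, ℂ) ∘L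
    SchwartzMap.smulLeftCLM ℂ (SchwartzMap.smulLeftCLM ℂ (dirSymbol v) (𝓕 f))

theorem coe_dirMultiplier (v : E) (f M : 𝓢(E, ℂ)) :
    ⇑(dirMultiplier v f M) = 𝓕⁻ (fun ξ => M ξ * (dirSymbol v ξ * 𝓕 (⇑f) ξ)) := by
  rw [dirMultiplier, ContinuousLinearMap.comp_apply, FourierTransform.fourierInvCLM_apply,
    SchwartzMap.fourierInv_coe]
  congr 1
  ext ξ
  rw [SchwartzMap.smulLeftCLM_apply_apply (SchwartzMap.hasTemperateGrowth _),
    SchwartzMap.smulLeftCLM_apply_apply (hasTemperateGrowth_dirSymbol v), SchwartzMap.fourier_coe,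
    smul_eq_mul, smul_eq_mul, mul_comm]

theorem eLpNorm_dirMultiplier_le (v : E) (f M : 𝓢(E, ℂ)) {p : ℝ≥0∞} (hp : 1 ≤ p) :
    eLpNorm (dirMultiplier v f M) p volume ≤
      ‖kernelL1 (SchwartzMap.smulLeftCLM ℂ (dirSymbol v) M)‖ₑ * eLpNorm f p volume := by
  rw [enorm_kernelL1, coe_dirMultiplier]
  refine le_trans (le_of_eq ?_) (SchwartzMap.eLpNorm_fourierInv_mul_fourier_le _ f hp)
  congr 2
  ext ξ
  rw [SchwartzMap.smulLeftCLM_apply_apply (hasTemperateGrowth_dirSymbol v), smul_eq_mul]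
  ring

theorem eLpNorm_dirMultiplier_le_fderiv (v : E) (f M : 𝓢(E, ℂ)) {p : ℝ≥0∞} (hp : 1 ≤ p) :
    eLpNorm (dirMultiplier v f M) p volume ≤
      ‖kernelL1 M‖ₑ * (‖v‖ₑ * eLpNorm (fun x => ‖fderiv ℝ f x‖) p volume) := by
  set g : 𝓢(E, ℂ) := (2 * Real.pi : ℂ)⁻¹ • ∂_{v} f with hg
  have hgξ : ∀ ξ, 𝓕 (⇑g) ξ = dirSymbol v ξ * 𝓕 (⇑f) ξ := by
    intro ξ
    have hpi : (Real.pi : ℂ) ≠ 0 := by exact_mod_cast Real.pi_ne_zero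
    rw [← SchwartzMap.fourier_coe, hg, FourierTransform.fourier_smul,
      SchwartzMap.fourier_lineDerivOp_eq, smul_apply, smul_apply,
      SchwartzMap.smulLeftCLM_apply_apply (by fun_prop), SchwartzMap.fourier_coe, dirSymbol,
      smul_eq_mul, smul_eq_mul, Complex.real_smul]
    field_simp
  have hgn : eLpNorm g p volume ≤ ‖v‖ₑ * eLpNorm (fun x => ‖fderiv ℝ f x‖) p volume := by
    refine (eLpNorm_le_mul_eLpNorm_of_ae_le_mul (c := ‖v‖)
      (Filter.Eventually.of_forall fun x => ?_) p).trans_eq (by rw [ofReal_norm])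
    have h2pi : ‖((2 * Real.pi : ℂ))⁻¹‖ ≤ 1 := by
      rw [norm_inv, norm_mul, Complex.norm_real, Real.norm_of_nonneg Real.pi_pos.le]
      refine inv_le_one_of_one_le₀ ?_
      have := Real.pi_gt_three
      norm_num
      linarith
    rw [hg, smul_apply, norm_smul, SchwartzMap.lineDerivOp_apply_eq_fderiv, norm_norm]
    calc _ ≤ 1 * (‖fderiv ℝ f x‖ * ‖v‖) := by
          gcongr
          exact ContinuousLinearMap.le_opNorm _ _
      _ = _ := by ring
  rw [enorm_kernelL1, coe_dirMultiplier]
  simp_rw [← hgξ]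
  exact (SchwartzMap.eLpNorm_fourierInv_mul_fourier_le M g hp).trans (by gcongr)

/-- If symbols `M n` are dominated and converge pointwise to `σ`, the `Lᵖ` norm of the limit
multiplier is controlled by the telescoping series. -/
theorem eLpNorm_fourierInv_le_add_tsum (v : E) (f : 𝓢(E, ℂ)) {p : ℝ≥0∞} (hp : 1 ≤ p) {σ : E → ℂ}
    (M : ℕ → 𝓢(E, ℂ)) {B : ℝ} (hB : ∀ n ξ, ‖M n ξ‖ ≤ B)
    (hM : ∀ ξ, Filter.Tendsto (fun n => M n ξ) Filter.atTop (nhds (σ ξ))) :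
    eLpNorm (𝓕⁻ (fun ξ => σ ξ * (dirSymbol v ξ * 𝓕 (⇑f) ξ))) p volume ≤
      eLpNorm (dirMultiplier v f (M 0)) p volume +
        ∑' k, eLpNorm (dirMultiplier v f (M (k + 1) - M k)) p volume := by
  have hlim : ∀ x, Filter.Tendsto (fun n => dirMultiplier v f (M n) x) Filter.atTop
      (nhds (𝓕⁻ (fun ξ => σ ξ * (dirSymbol v ξ * 𝓕 (⇑f) ξ)) x)) := by
    intro x
    simp_rw [coe_dirMultiplier, Real.fourierInv_eq]
    set g := SchwartzMap.smulLeftCLM ℂ (dirSymbol v) (𝓕 f) with hg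
    have hgξ : ∀ ξ, dirSymbol v ξ * 𝓕 (⇑f) ξ = g ξ := fun ξ => by
      rw [hg, SchwartzMap.smulLeftCLM_apply_apply (hasTemperateGrowth_dirSymbol v), smul_eq_mul,
        SchwartzMap.fourier_coe]
    simp_rw [hgξ]
    refine tendsto_integral_of_dominated_convergence (fun ξ => B * ‖g ξ‖) (fun n => ?_)
      (g.integrable.norm.const_mul B) (fun n => Filter.Eventually.of_forall fun ξ => ?_)
      (Filter.Eventually.of_forall fun ξ => ?_)
    · have h1 := (M n).continuous
      have h2 := g.continuous
      have h3 := Real.continuous_fourierChar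
      simp_rw [Circle.smul_def]
      exact Continuous.aestronglyMeasurable (by fun_prop)
    · rw [Circle.norm_smul, norm_mul]
      gcongr
      exact hB n ξ
    · exact ((hM ξ).mul_const _).const_smul _
  have hsum : ∀ n, eLpNorm (dirMultiplier v f (M n)) p volume ≤
      eLpNorm (dirMultiplier v f (M 0)) p volume +
        ∑ k ∈ Finset.range n, eLpNorm (dirMultiplier v f (M (k + 1) - M k)) p volume := by
    intro n
    induction n with
    | zero => simp
    | succ n ih =>
      have h1 : dirMultiplier v f (M (n + 1)) =
          dirMultiplier v f (M n) + dirMultiplier v f (M (n + 1) - M n) := by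
        rw [← map_add, add_sub_cancel]
      rw [h1, Finset.sum_range_succ, ← add_assoc]
      refine (eLpNorm_add_le (SchwartzMap.continuous _).aestronglyMeasurable
        (SchwartzMap.continuous _).aestronglyMeasurable hp).trans ?_
      gcongr
  refine (Lp.eLpNorm_lim_le_liminf_eLpNorm
    (fun n => (dirMultiplier v f (M n)).continuous.aestronglyMeasurable) _
    (Filter.Eventually.of_forall hlim)).trans ?_
  refine Filter.liminf_le_of_frequently_le' (Filter.Frequently.of_forall fun n => ?_)
  exact (hsum n).trans (by gcongr; exact ENNReal.sum_le_tsum _)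

/-- Interpolation bound for a multiplier `σ(ξ) i⟨ξ, v⟩` with `σ` a symbol of order `-δ`. -/
theorem exists_eLpNorm_multiplier_le {σ : E → ℂ} {δ : ℝ} (hδ : 0 < δ)
    (hσ : ContDiff ℝ (⊤ : ℕ∞) σ)
    (hσbd : ∀ n : ℕ, ∃ Cn : ℝ, ∀ ξ,
      ‖iteratedFDeriv ℝ n σ ξ‖ ≤ Cn * (1 + ‖ξ‖ ^ 2) ^ (-(δ + n) / 2 : ℝ))
    {p : ℝ≥0∞} (hp : 1 ≤ p) (v : E) :
    ∃ C : ℝ≥0, ∀ f : 𝓢(E, ℂ),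
      eLpNorm (𝓕⁻ (fun ξ => σ ξ * (dirSymbol v ξ * 𝓕 (⇑f) ξ))) p volume ≤
        C * eLpNorm (fun x => ‖fderiv ℝ f x‖) p volume ∧
      eLpNorm (𝓕⁻ (fun ξ => σ ξ * (dirSymbol v ξ * 𝓕 (⇑f) ξ))) p volume ≤
        C * eLpNorm f p volume ^ (δ / (1 + δ)) *
          eLpNorm (fun x => ‖fderiv ℝ f x‖) p volume ^ (1 / (1 + δ)) := by
  let b : ContDiffBump (0 : E) := ⟨1, 2, one_pos, one_lt_two⟩
  let χ : E → ℂ := fun ξ => (b ξ : ℂ)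
  have hχ : ContDiff ℝ (⊤ : ℕ∞) χ := Complex.ofRealCLM.contDiff.comp b.contDiff
  have hχ1 : ∀ ξ, ‖ξ‖ ≤ 1 → χ ξ = 1 := fun ξ hξ => by
    simp [χ, b.one_of_mem_closedBall (mem_closedBall_zero_iff.2 hξ)]
  have hχ0 : ∀ ξ, 2 ≤ ‖ξ‖ → χ ξ = 0 := fun ξ hξ => by
    have : b ξ = 0 := b.zero_of_le_dist (by simpa [b] using hξ)
    simp [χ, this]
  have hχn : ∀ ξ, ‖χ ξ‖ ≤ 1 := fun ξ => by
    rw [Complex.norm_real, Real.norm_of_nonneg b.nonneg]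
    exact b.le_one
  -- smooth frequency truncations of `σ`
  have hMc : ∀ n : ℕ, HasCompactSupport fun ξ => σ ξ * χ (((2 : ℝ) ^ n)⁻¹ • ξ) := fun n => by
    refine HasCompactSupport.intro (isCompact_closedBall (0 : E) (2 ^ n * 2)) fun ξ hξ => ?_
    rw [hχ0, mul_zero]
    rw [mem_closedBall_zero_iff, not_le] at hξ
    rw [norm_smul, norm_inv, norm_pow, Real.norm_two, ← div_eq_inv_mul, le_div_iff₀ (by positivity)]
    linarith
  have hMs : ∀ n : ℕ, ContDiff ℝ (⊤ : ℕ∞) fun ξ => σ ξ * χ (((2 : ℝ) ^ n)⁻¹ • ξ) := fun n => by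
    fun_prop
  let M : ℕ → 𝓢(E, ℂ) := fun n => (hMc n).toSchwartzMap (hMs n)
  -- the dyadic pieces, rescaled to unit frequency
  let ψ : E → ℂ := fun ξ => χ ((2 : ℝ)⁻¹ • ξ) - χ ξ
  have hψ : ContDiff ℝ (⊤ : ℕ∞) ψ := by fun_prop
  have hψ4 : tsupport ψ ⊆ Metric.closedBall 0 4 := by
    refine closure_minimal (fun ξ hξ => ?_) Metric.isClosed_closedBall
    by_contra h
    rw [mem_closedBall_zero_iff, not_le] at h
    refine hξ ?_
    have : 2 ≤ ‖(2 : ℝ)⁻¹ • ξ‖ := by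
      rw [norm_smul, norm_inv, Real.norm_two]
      linarith
    simp [ψ, hχ0 _ this, hχ0 ξ (by linarith)]
  have hψ1 : ∀ ξ ∈ tsupport ψ, 1 ≤ ‖ξ‖ := by
    refine fun ξ hξ => closure_minimal (t := {ξ : E | 1 ≤ ‖ξ‖}) (fun ξ hξ => ?_)
      (isClosed_le continuous_const continuous_norm) hξ
    by_contra h
    rw [Set.mem_ofPred_eq, not_le] at h
    refine hξ ?_
    have : ‖(2 : ℝ)⁻¹ • ξ‖ ≤ 1 := by
      rw [norm_smul, norm_inv, Real.norm_two]
      linarith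
    simp [ψ, hχ1 _ this, hχ1 ξ h.le]
  have hψc : HasCompactSupport ψ :=
    (isCompact_closedBall (0 : E) 4).of_isClosed_subset (isClosed_tsupport ψ) hψ4
  have hmc : ∀ k : ℕ, HasCompactSupport fun ξ => σ ((2 : ℝ) ^ k • ξ) * ψ ξ := fun k =>
    hψc.mul_left
  have hms : ∀ k : ℕ, ContDiff ℝ (⊤ : ℕ∞) fun ξ => σ ((2 : ℝ) ^ k • ξ) * ψ ξ := fun k => by
    fun_prop
  let m : ℕ → 𝓢(E, ℂ) := fun k => (hmc k).toSchwartzMap (hms k)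
  have hmbd := exists_norm_iteratedFDeriv_dilate_mul_le hδ hσ hσbd hψ hψc hψ1
  have hmsupp : ∀ k, tsupport (m k) ⊆ Metric.closedBall 0 4 := fun k =>
    tsupport_mul_subset_right.trans hψ4
  have hDm : ∀ k ξ, (M (k + 1) - M k) ξ = m k (((2 : ℝ) ^ k)⁻¹ • ξ) := fun k ξ => by
    have h2 : (2 : ℝ) ^ k ≠ 0 := by positivity
    change σ ξ * χ (((2 : ℝ) ^ (k + 1))⁻¹ • ξ) - σ ξ * χ (((2 : ℝ) ^ k)⁻¹ • ξ) =
      σ ((2 : ℝ) ^ k • ((2 : ℝ) ^ k)⁻¹ • ξ) *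
        (χ ((2 : ℝ)⁻¹ • ((2 : ℝ) ^ k)⁻¹ • ξ) - χ (((2 : ℝ) ^ k)⁻¹ • ξ))
    rw [smul_inv_smul₀ h2, smul_smul, ← mul_inv, ← pow_succ', mul_sub]
  obtain ⟨C₁, hC₁⟩ := SchwartzMap.exists_norm_map_le kernelL1 m _ 4 hmsupp hmbd
  obtain ⟨C₂, hC₂⟩ := SchwartzMap.exists_norm_map_le
    (kernelL1 ∘L SchwartzMap.smulLeftCLM ℂ (dirSymbol v)) m _ 4 hmsupp hmbd
  have hr0 : (0 : ℝ) ≤ 2 ^ (-δ) := by positivity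
  have hr1 : (2 : ℝ) ^ (-δ) ≤ 1 := Real.rpow_le_one_of_one_le_of_nonpos one_le_two (by linarith)
  have hrr : ‖(2 : ℝ) ^ (-δ)‖ₑ = (((2 : ℝ≥0) ^ (-δ) : ℝ≥0) : ℝ≥0∞) := by
    rw [enorm_eq_nnnorm]
    congr 1
    ext
    simp [Real.norm_of_nonneg hr0]
  have hD₁ : ∀ k, ‖kernelL1 (M (k + 1) - M k)‖ₑ ≤
      ‖C₁‖ₑ * (((2 : ℝ≥0) ^ (-δ) : ℝ≥0) : ℝ≥0∞) ^ k := fun k => by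
    rw [enorm_kernelL1_eq_of_dilate (by positivity) (hDm k), ← hrr, ← enorm_pow, ← enorm_mul]
    exact enorm_le_iff_norm_le.2 ((hC₁ k).trans (le_abs_self _))
  have hD₂ : ∀ k, ‖kernelL1 (SchwartzMap.smulLeftCLM ℂ (dirSymbol v) (M (k + 1) - M k))‖ₑ ≤
      ‖C₂‖ₑ * 2 ^ k := fun k => by
    have h2 : ((2 : ℝ) ^ k) ≠ 0 := by positivity
    have hdil : ∀ ξ, SchwartzMap.smulLeftCLM ℂ (dirSymbol v) (M (k + 1) - M k) ξ =
        ((2 : ℂ) ^ k • SchwartzMap.smulLeftCLM ℂ (dirSymbol v) (m k)) (((2 : ℝ) ^ k)⁻¹ • ξ) := by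
      intro ξ
      rw [smul_apply,
        SchwartzMap.smulLeftCLM_apply_apply (hasTemperateGrowth_dirSymbol v),
        SchwartzMap.smulLeftCLM_apply_apply (hasTemperateGrowth_dirSymbol v), hDm, dirSymbol,
        dirSymbol, inner_smul_left]
      simp only [smul_eq_mul, conj_trivial]
      push_cast
      field_simp
    rw [enorm_kernelL1_eq_of_dilate (by positivity) hdil, map_smul, enorm_smul, mul_comm]
    gcongr
    · refine enorm_le_iff_norm_le.2 ((hC₂ k).trans ?_)
      calc C₂ * ((2 : ℝ) ^ (-δ)) ^ k ≤ |C₂| * 1 := by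
            gcongr
            · exact le_abs_self _
            · exact pow_le_one₀ hr0 hr1
        _ = ‖C₂‖ := by rw [mul_one, Real.norm_eq_abs]
    · rw [enorm_pow]
      gcongr
      simp [enorm_eq_nnnorm]
  obtain ⟨B, hB⟩ := hσbd 0
  have hσB : ∀ ξ, ‖σ ξ‖ ≤ |B| := fun ξ => by
    have h := hB ξ
    rw [norm_iteratedFDeriv_zero] at h
    calc _ ≤ |B| * (1 + ‖ξ‖ ^ 2) ^ (-(δ + (0 : ℕ)) / 2 : ℝ) := h.trans (by gcongr; exact le_abs_self B)
      _ ≤ |B| * 1 := by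
        gcongr
        exact Real.rpow_le_one_of_one_le_of_nonpos (by nlinarith [sq_nonneg ‖ξ‖])
          (by push_cast; linarith)
      _ = _ := mul_one _
  have hMB : ∀ n ξ, ‖M n ξ‖ ≤ |B| := fun n ξ => by
    calc ‖M n ξ‖ = ‖σ ξ‖ * ‖χ (((2 : ℝ) ^ n)⁻¹ • ξ)‖ := norm_mul _ _
      _ ≤ |B| * 1 := by
        gcongr
        · exact hσB ξ
        · exact hχn _
      _ = _ := mul_one _
  have hMlim : ∀ ξ, Filter.Tendsto (fun n => M n ξ) Filter.atTop (nhds (σ ξ)) := fun ξ => by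
    refine tendsto_const_nhds.congr' ?_
    filter_upwards [(tendsto_pow_atTop_atTop_of_one_lt (one_lt_two (α := ℝ))).eventually_ge_atTop
      ‖ξ‖] with n hn
    have : ‖((2 : ℝ) ^ n)⁻¹ • ξ‖ ≤ 1 := by
      rw [norm_smul, norm_inv, norm_pow, Real.norm_two, ← div_eq_inv_mul]
      exact div_le_one_of_le₀ hn (by positivity)
    simp [M, hχ1 _ this]
  set K : ℝ≥0 := (‖kernelL1 (M 0)‖₊ + ‖C₁‖₊) * ‖v‖₊ +
    (‖kernelL1 (SchwartzMap.smulLeftCLM ℂ (dirSymbol v) (M 0))‖₊ + ‖C₂‖₊) with hK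
  have hKe : (K : ℝ≥0∞) = (‖kernelL1 (M 0)‖ₑ + ‖C₁‖ₑ) * ‖v‖ₑ +
      (‖kernelL1 (SchwartzMap.smulLeftCLM ℂ (dirSymbol v) (M 0))‖ₑ + ‖C₂‖ₑ) := by
    rw [hK]
    push_cast
    rfl
  have hK₁ : ‖kernelL1 (M 0)‖ₑ * ‖v‖ₑ ≤ K := by
    rw [hKe, add_mul, add_assoc]; exact le_self_add
  have hK₂ : ‖C₁‖ₑ * ‖v‖ₑ ≤ K := by
    rw [hKe, add_mul, add_comm (_ * _), add_assoc]; exact le_self_add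
  have hK₃ : ‖kernelL1 (SchwartzMap.smulLeftCLM ℂ (dirSymbol v) (M 0))‖ₑ ≤ K := by
    rw [hKe]; exact le_self_add.trans le_add_self
  have hK₄ : ‖C₂‖ₑ ≤ K := by
    rw [hKe]; exact le_add_self.trans le_add_self
  refine ⟨3 * (K * (1 + (1 - (2 : ℝ≥0) ^ (-δ))⁻¹)), fun f => ?_⟩
  have hF := (f.memLp p volume).eLpNorm_ne_top
  have hG : eLpNorm (fun x => ‖fderiv ℝ f x‖) p volume ≠ ∞ := by
    rw [eLpNorm_norm]
    exact ((SchwartzMap.fderivCLM ℝ E ℂ f).memLp p volume).eLpNorm_ne_top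
  have hX := eLpNorm_fourierInv_le_add_tsum v f hp M hMB hMlim
  have ha := eLpNorm_dirMultiplier_le v f (M 0) hp
  have ha' := eLpNorm_dirMultiplier_le_fderiv v f (M 0) hp
  have hb := fun k => eLpNorm_dirMultiplier_le v f (M (k + 1) - M k) hp
  have hb' := fun k => eLpNorm_dirMultiplier_le_fderiv v f (M (k + 1) - M k) hp
  lift eLpNorm f p volume to ℝ≥0 using hF with F
  lift eLpNorm (fun x => ‖fderiv ℝ f x‖) p volume to ℝ≥0 using hG with G
  obtain ⟨h1, h2⟩ := le_rpow_mul_rpow_of_le_tsum (F := F) (G := G) (C := K) hδ hX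
    (ha.trans (by gcongr)) (ha'.trans (by rw [← mul_assoc]; gcongr))
    (fun k => (hb k).trans (by gcongr; exact (hD₂ k).trans (by gcongr)))
    (fun k => (hb' k).trans (by
      calc _ ≤ (‖C₁‖ₑ * (((2 : ℝ≥0) ^ (-δ) : ℝ≥0) : ℝ≥0∞) ^ k) * (‖v‖ₑ * G) := by
            gcongr; exact hD₁ k
        _ = ‖C₁‖ₑ * ‖v‖ₑ * (((2 : ℝ≥0) ^ (-δ) : ℝ≥0) : ℝ≥0∞) ^ k * G := by ring
        _ ≤ _ := by gcongr))
  exact ⟨h1.trans (mul_le_mul' (ENNReal.coe_le_coe.2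
    (le_mul_of_one_le_left zero_le (by norm_num : (1 : ℝ≥0) ≤ 3))) le_rfl), h2⟩

end DyadicSum

/-- for a smooth symbol `σ` with `|∂^α σ(ξ)| ≤ C_α ⟨ξ⟩^{−δ−|α|}` (`δ > 0`),
the multiplier with symbol `σ(ξ)·iξ_j` satisfies, on each `L^p`, the interpolation bound
`‖𝓕⁻(σ(ξ) iξ_j f̂)‖_p ≤ C ‖f‖_p^{δ/(1+δ)} ‖|∇f|‖_p^{1/(1+δ)}`, and in particular is
bounded by `C` times the `W^{1,p}` norm of `f`. -/
theorem stmt11 (d : ℕ) (hd : 1 ≤ d) (δ : ℝ) (hδ : 0 < δ)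
    (σ : EuclideanSpace ℝ (Fin d) → ℂ) (hσsmooth : ContDiff ℝ (⊤ : ℕ∞) σ)
    (hσbd : ∀ n : ℕ, ∃ Cn : ℝ, ∀ ξ,
      ‖iteratedFDeriv ℝ n σ ξ‖ ≤ Cn * (1 + ‖ξ‖ ^ 2) ^ (-(δ + n) / 2 : ℝ))
    (p : ℝ≥0∞) (hp : 1 ≤ p) :
    ∃ C : ℝ≥0, ∀ f : SchwartzMap (EuclideanSpace ℝ (Fin d)) ℂ, ∀ j : Fin d,
      eLpNorm (𝓕⁻ (fun ξ => σ ξ * (Complex.I * ((ξ j : ℝ) : ℂ)) * 𝓕 (⇑f) ξ)) p volume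
          ≤ C * (eLpNorm (⇑f) p volume) ^ (δ / (1 + δ))
              * (eLpNorm (fun x => ‖fderiv ℝ (⇑f) x‖) p volume) ^ (1 / (1 + δ)) ∧
        eLpNorm (𝓕⁻ (fun ξ => σ ξ * (Complex.I * ((ξ j : ℝ) : ℂ)) * 𝓕 (⇑f) ξ)) p volume
          ≤ C * (eLpNorm (⇑f) p volume
              + eLpNorm (fun x => ‖fderiv ℝ (⇑f) x‖) p volume) := by
  choose C hC using fun j : Fin d =>
    exists_eLpNorm_multiplier_le hδ hσsmooth hσbd hp (EuclideanSpace.single j (1 : ℝ))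
  refine ⟨∑ j, C j, fun f j => ?_⟩
  have hsymb : (fun ξ => σ ξ * (Complex.I * ((ξ j : ℝ) : ℂ)) * 𝓕 (⇑f) ξ) =
      fun ξ => σ ξ * (dirSymbol (EuclideanSpace.single j (1 : ℝ)) ξ * 𝓕 (⇑f) ξ) := by
    ext ξ
    simp [dirSymbol, EuclideanSpace.inner_single_right, mul_assoc]
  have hCj : C j ≤ ∑ j, C j := Finset.single_le_sum (fun _ _ => zero_le) (Finset.mem_univ j)
  rw [hsymb]
  refine ⟨(hC j f).2.trans (by gcongr), (hC j f).1.trans ?_⟩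
  gcongr
  exact le_add_self
end
end

section
/- Let θ ∈ [0, 3/2], let A ≥ 0, and let g : {(s,t) : 0 ≤ s ≤ t} → [0,∞) be measurable. Suppose there is a measurable a : [0,∞) → [0,∞) with ∫₀^∞ a(s) ds ≤ 1 such that g(s,t) ≤ A (1+(t−s)²)^{−θ/2} a(s) for all 0 ≤ s ≤ t, and suppose also g(s,t) ≤ A (1+s²)^{−5/4} for all 0 ≤ s ≤ t. Then there is a universal constant C (independent of g, a, A, θ) such that ∫₀ᵗ g(s,t) ds ≤ C A (1+t²)^{−θ/2} for all t ≥ 0. -/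
noncomputable section
open MeasureTheory Set

theorem rpow_neg_le_of_quarter_le {x y p : ℝ} (hx : 0 < x) (hxy : x / 4 ≤ y)
    (hp0 : 0 ≤ p) (hp2 : p ≤ 2) : y ^ (-p) ≤ 16 * x ^ (-p) := by
  have h1 : y ^ (-p) ≤ (x / 4) ^ (-p) :=
    Real.rpow_le_rpow_of_nonpos (by positivity) hxy (by linarith)
  have h2 : (x / 4) ^ (-p) = 4 ^ p * x ^ (-p) := by
    rw [Real.div_rpow hx.le (by norm_num), Real.rpow_neg (by norm_num : (0 : ℝ) ≤ 4),
      div_inv_eq_mul, mul_comm]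
  have h3 : (4 : ℝ) ^ p ≤ 16 := by
    calc (4 : ℝ) ^ p ≤ 4 ^ (2 : ℝ) := Real.rpow_le_rpow_of_exponent_le (by norm_num) hp2
      _ = 16 := by norm_num
  rw [h2] at h1
  exact h1.trans (mul_le_mul_of_nonneg_right h3 (by positivity))

theorem japanese_rpow_neg_five_fourths_le {θ t : ℝ} (hθ : θ ≤ 3 / 2) :
    (1 + t ^ 2) ^ (-(5 / 4) : ℝ) ≤ (1 + t ^ 2) ^ (-(θ / 2)) * (1 + t ^ 2) ^ (-(1 / 2) : ℝ) := by
  rw [← Real.rpow_add (by positivity)]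
  exact Real.rpow_le_rpow_of_exponent_le (by nlinarith [sq_nonneg t]) (by linarith)

theorem mul_japanese_rpow_neg_half_le_one (t : ℝ) :
    t * (1 + t ^ 2) ^ (-(1 / 2) : ℝ) ≤ 1 := by
  rw [Real.rpow_neg (by positivity), ← Real.sqrt_eq_rpow, ← div_eq_mul_inv,
    div_le_one (by positivity)]
  exact Real.le_sqrt_of_sq_le (by linarith)

theorem integrableOn_and_integral_le_one_of_lintegral_le_one {a : ℝ → ℝ} {s : Set ℝ}
    (ha : Measurable a) (ha0 : ∀ x, 0 ≤ a x) (h : (∫⁻ x in s, ENNReal.ofReal (a x)) ≤ 1) :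
    IntegrableOn a s ∧ ∫ x in s, a x ≤ 1 := by
  refine ⟨(lintegral_ofReal_ne_top_iff_integrable ha.aestronglyMeasurable
    (ae_of_all _ ha0)).1 (ne_top_of_le_ne_top ENNReal.one_ne_top h), ?_⟩
  rw [integral_eq_lintegral_of_nonneg_ae (ae_of_all _ ha0) ha.aestronglyMeasurable]
  exact ENNReal.toReal_le_of_le_ofReal zero_le_one (by simpa using h)

/-- abstract Duhamel-decay mechanism: if `g(s,t) ≤ A⟨t−s⟩^{−θ} a(s)` with
`∫₀^∞ a ≤ 1`, and also `g(s,t) ≤ A⟨s⟩^{−5/2}`, then `∫₀ᵗ g(s,t) ds ≤ C A ⟨t⟩^{−θ}` for a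
universal constant `C` (independent of `g, a, A, θ ∈ [0,3/2]`). -/
theorem stmt14 :
    ∃ C : ℝ, 0 < C ∧
      ∀ θ A : ℝ, 0 ≤ θ → θ ≤ 3 / 2 → 0 ≤ A →
        ∀ g : ℝ → ℝ → ℝ, Measurable (Function.uncurry g) →
          (∀ s t : ℝ, 0 ≤ s → s ≤ t → 0 ≤ g s t) →
          (∃ a : ℝ → ℝ, Measurable a ∧ (∀ s, 0 ≤ a s) ∧
            (∫⁻ s in Ioi (0:ℝ), ENNReal.ofReal (a s)) ≤ 1 ∧
            ∀ s t : ℝ, 0 ≤ s → s ≤ t →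
              g s t ≤ A * (1 + (t - s) ^ 2) ^ (-(θ / 2)) * a s) →
          (∀ s t : ℝ, 0 ≤ s → s ≤ t → g s t ≤ A * (1 + s ^ 2) ^ (-(5 / 4) : ℝ)) →
          ∀ t : ℝ, 0 ≤ t →
            (∫ s in (0:ℝ)..t, g s t) ≤ C * A * (1 + t ^ 2) ^ (-(θ / 2)) := by
  refine ⟨32, by norm_num, ?_⟩
  rintro θ A hθ0 hθ hA g - hg0 ⟨a, ha, ha0, haI, hga⟩ hg t ht
  set W := (1 + t ^ 2) ^ (-(θ / 2))
  set R := (1 + t ^ 2) ^ (-(1 / 2) : ℝ)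
  have hW0 : 0 ≤ W := by positivity
  have hR0 : 0 ≤ R := by positivity
  have hbound : ∀ s ∈ Ioc 0 t, g s t ≤ 16 * A * W * a s + 16 * A * W * R := by
    rintro s ⟨hs0, hst⟩
    have has := ha0 s
    rcases le_total s (t / 2) with hs | hs
    · have hdecay : (1 + (t - s) ^ 2) ^ (-(θ / 2)) ≤ 16 * W :=
        rpow_neg_le_of_quarter_le (by positivity) (by nlinarith) (by linarith) (by linarith)
      calc g s t ≤ A * (1 + (t - s) ^ 2) ^ (-(θ / 2)) * a s := hga s t hs0.le hst
        _ ≤ A * (16 * W) * a s := by gcongr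
        _ = 16 * A * W * a s := by ring
        _ ≤ _ := le_add_of_nonneg_right (by positivity)
    · have hdecay : (1 + s ^ 2) ^ (-(5 / 4) : ℝ) ≤ 16 * (1 + t ^ 2) ^ (-(5 / 4) : ℝ) :=
        rpow_neg_le_of_quarter_le (by positivity) (by nlinarith) (by norm_num) (by norm_num)
      calc g s t ≤ A * (1 + s ^ 2) ^ (-(5 / 4) : ℝ) := hg s t hs0.le hst
        _ ≤ A * (16 * (W * R)) := by
          gcongr
          exact hdecay.trans (by gcongr; exact japanese_rpow_neg_five_fourths_le hθ)
        _ = 16 * A * W * R := by ring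
        _ ≤ _ := le_add_of_nonneg_left (by positivity)
  obtain ⟨haInt, ha1⟩ := integrableOn_and_integral_le_one_of_lintegral_le_one ha ha0
    ((lintegral_mono_set (Ioc_subset_Ioi_self : Ioc 0 t ⊆ Ioi 0)).trans haI)
  have hconst : IntegrableOn (fun _ : ℝ => 16 * A * W * R) (Ioc 0 t) :=
    integrableOn_const (by simp)
  rw [intervalIntegral.integral_of_le ht]
  calc ∫ s in Ioc 0 t, g s t
      ≤ ∫ s in Ioc 0 t, (16 * A * W * a s + 16 * A * W * R) :=
        integral_mono_of_nonneg
          (ae_restrict_of_forall_mem measurableSet_Ioc fun s hs => hg0 s t hs.1.le hs.2)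
          ((haInt.const_mul _).add hconst)
          (ae_restrict_of_forall_mem measurableSet_Ioc hbound)
    _ = 16 * A * W * (∫ s in Ioc 0 t, a s) + 16 * A * W * (t * R) := by
        rw [integral_add (haInt.const_mul _) hconst, integral_const_mul]
        simp [ht]
        ring
    _ ≤ 16 * A * W * 1 + 16 * A * W * 1 := by
        gcongr
        exact mul_japanese_rpow_neg_half_le_one t
    _ = 32 * A * W := by ring
end
end
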